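/- As n → ∞, the number q(n) of plane partitions of n satisfies the asymptotic equivalence q(n) ~ (ζ(3)^{7/36} / (2^{11/36} · 3^{1/2} · π^{1/2})) · n^{−25/36} · exp( 3 ζ(3)^{1/3} (n/2)^{2/3} + 2c ); that is, the ratio of q(n) to the right-hand side tends to 1. (Equivalently, Wright's asymptotic formula for q(n) holds with leading coefficient γ₀ = 3^{−1/2}, not γ₀ = 1.) -/

import Mathlib

open Real Filter

/-- The number of plane partitions of `n`: arrays `ω : ℕ → ℕ → ℕ` (indices shifted to start
at 0) that are weakly decreasing along rows and columns and whose entries sum to `n`. -/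
noncomputable def planePartitionCount (n : ℕ) : ℕ :=
  Nat.card {ω : ℕ → ℕ → ℕ //
    (∀ i j, ω (i + 1) j ≤ ω i j) ∧ (∀ i j, ω i (j + 1) ≤ ω i j) ∧
    (∑' p : ℕ × ℕ, ω p.1 p.2) = n}

/-- `ζ(3)` as a real number. -/
noncomputable def zeta3 : ℝ := ∑' j : ℕ, 1 / ((j : ℝ) + 1) ^ 3

/-- The constant `c = ∫₀^∞ y log y / (e^{2πy} - 1) dy`. -/
noncomputable def cConst : ℝ := ∫ y in Set.Ioi (0 : ℝ), y * Real.log y / (Real.exp (2 * π * y) - 1)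

/-- The sum of the entries of a finitely supported sequence. -/
noncomputable def seqSize (f : ℕ →₀ ℕ) : ℕ := ∑' i, f i

/-- `Interlace f g` says `f 0 ≥ g 0 ≥ f 1 ≥ g 1 ≥ ⋯`. -/
def Interlace (f g : ℕ →₀ ℕ) : Prop := ∀ i, g i ≤ f i ∧ f (i + 1) ≤ g i

theorem exists_forall_ge_eq_zero (f : ℕ →₀ ℕ) : ∃ N, ∀ n, N ≤ n → f n = 0 := by
  refine ⟨f.support.sup id + 1, fun n hn => ?_⟩
  by_contra h
  have : id n ≤ f.support.sup id := Finset.le_sup (Finsupp.mem_support_iff.2 h)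
  simp at this
  omega

theorem seqSize_eq_sum_range {f : ℕ →₀ ℕ} {N : ℕ} (h : ∀ n, N ≤ n → f n = 0) :
    seqSize f = ∑ i ∈ Finset.range N, f i :=
  tsum_eq_sum fun i hi => h i (by simpa using hi)

@[simp] theorem seqSize_zero : seqSize 0 = 0 := by simp [seqSize]

theorem Interlace.seqSize_le {f g : ℕ →₀ ℕ} (h : Interlace f g) : seqSize g ≤ seqSize f := by
  obtain ⟨N, hN⟩ := exists_forall_ge_eq_zero f
  have hg : ∀ n, N ≤ n → g n = 0 := fun n hn => by have := (h n).1; have := hN n hn; omega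
  rw [seqSize_eq_sum_range hN, seqSize_eq_sum_range hg]
  exact Finset.sum_le_sum fun i _ => (h i).1

theorem interlace_zero_left {g : ℕ →₀ ℕ} : Interlace 0 g ↔ g = 0 := by
  constructor
  · intro h; ext i; have := (h i).1; simpa using this
  · rintro rfl i; simp

/-- The upward local transformation: the sequence above `f` and `g` built from
a sequence `k` below both and a new part `m`. -/
noncomputable def toggleUp (f g k : ℕ →₀ ℕ) (m : ℕ) : ℕ →₀ ℕ :=
  Finsupp.ofSupportFinite
    (fun i => Nat.casesOn i (max (f 0) (g 0) + m)
      fun j => max (f (j + 1)) (g (j + 1)) + min (f j) (g j) - k j) (by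
    obtain ⟨N, hN⟩ := exists_forall_ge_eq_zero f
    obtain ⟨M, hM⟩ := exists_forall_ge_eq_zero g
    refine (Set.finite_Iio (N + M + 1)).subset fun i hi => ?_
    by_contra h
    simp only [Set.mem_Iio, not_lt] at h
    obtain ⟨j, rfl⟩ : ∃ j, i = j + 1 := ⟨i - 1, by omega⟩
    apply hi
    simp [hN j (by omega), hN (j + 1) (by omega), hM j (by omega), hM (j + 1) (by omega)])

/-- The downward local transformation, inverse to `toggleUp`. -/
noncomputable def toggleDown (f g n : ℕ →₀ ℕ) : ℕ →₀ ℕ :=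
  Finsupp.ofSupportFinite
    (fun j => max (f (j + 1)) (g (j + 1)) + min (f j) (g j) - n (j + 1)) (by
    obtain ⟨N, hN⟩ := exists_forall_ge_eq_zero f
    obtain ⟨M, hM⟩ := exists_forall_ge_eq_zero g
    refine (Set.finite_Iio (N + M + 1)).subset fun j hi => ?_
    by_contra h
    simp only [Set.mem_Iio, not_lt] at h
    apply hi
    simp [hN j (by omega), hN (j + 1) (by omega), hM j (by omega), hM (j + 1) (by omega)])

theorem toggleUp_zero (f g k : ℕ →₀ ℕ) (m : ℕ) :
    toggleUp f g k m 0 = max (f 0) (g 0) + m := rfl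

theorem toggleUp_succ (f g k : ℕ →₀ ℕ) (m j : ℕ) : toggleUp f g k m (j + 1) =
    max (f (j + 1)) (g (j + 1)) + min (f j) (g j) - k j := rfl

theorem toggleDown_apply (f g n : ℕ →₀ ℕ) (j : ℕ) : toggleDown f g n j =
    max (f (j + 1)) (g (j + 1)) + min (f j) (g j) - n (j + 1) := rfl

/-- Sequences interlacing above both `f` and `g` correspond to sequences interlacing below both
together with a natural number. -/
noncomputable def toggleEquiv (f g : ℕ →₀ ℕ) :
    {k : ℕ →₀ ℕ // Interlace f k ∧ Interlace g k} × ℕ ≃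
      {n : ℕ →₀ ℕ // Interlace n f ∧ Interlace n g} where
  toFun p := ⟨toggleUp f g p.1.1 p.2, by
    obtain ⟨⟨k, hf, hg⟩, m⟩ := p
    constructor <;> rintro (_ | i) <;> simp only [toggleUp_zero, toggleUp_succ, zero_add]
    · have h := hf 0; have h' := hg 0; rw [zero_add] at h h'; omega
    · have := hf i; have := hg i; have := hf (i + 1); have := hg (i + 1); omega
    · have h := hf 0; have h' := hg 0; rw [zero_add] at h h'; omega
    · have := hf i; have := hg i; have := hf (i + 1); have := hg (i + 1); omega⟩
  invFun n := (⟨toggleDown f g n.1, by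
    obtain ⟨n, hf, hg⟩ := n
    constructor <;> intro i <;> simp only [toggleDown_apply]
    all_goals have := hf i; have := hg i; have := hf (i + 1); have := hg (i + 1); omega⟩,
    n.1 0 - max (f 0) (g 0))
  left_inv := by
    rintro ⟨⟨k, hf, hg⟩, m⟩
    ext i
    · simp only [toggleDown_apply, toggleUp_succ]
      have := hf i; have := hg i; omega
    · simp [toggleUp_zero]
  right_inv := by
    rintro ⟨n, hf, hg⟩
    ext (_ | i)
    · simp only [toggleUp_zero]
      have := hf 0; have := hg 0; omega
    · simp only [toggleUp_succ, toggleDown_apply]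
      have := hf i; have := hg i; have := hf (i + 1); have := hg (i + 1); omega

theorem seqSize_toggleUp {f g k : ℕ →₀ ℕ} (hf : Interlace f k) (hg : Interlace g k) (m : ℕ) :
    seqSize (toggleUp f g k m) + seqSize k = seqSize f + seqSize g + m := by
  obtain ⟨N, hN⟩ := exists_forall_ge_eq_zero f
  obtain ⟨M, hM⟩ := exists_forall_ge_eq_zero g
  have hf0 : ∀ n, N + M ≤ n → f n = 0 := fun n hn => hN n (by omega)
  have hg0 : ∀ n, N + M ≤ n → g n = 0 := fun n hn => hM n (by omega)
  have hk0 : ∀ n, N + M ≤ n → k n = 0 := fun n hn => by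
    have := (hf n).1; have := hf0 n hn; omega
  have hu0 : ∀ n, N + M + 1 ≤ n → toggleUp f g k m n = 0 := by
    intro n hn
    obtain ⟨j, rfl⟩ : ∃ j, n = j + 1 := ⟨n - 1, by omega⟩
    simp [toggleUp_succ, hf0 j (by omega), hf0 (j + 1) (by omega), hg0 j (by omega),
      hg0 (j + 1) (by omega)]
  rw [seqSize_eq_sum_range hf0, seqSize_eq_sum_range hg0, seqSize_eq_sum_range hk0,
    seqSize_eq_sum_range hu0, Finset.sum_range_succ', toggleUp_zero]
  have h1 : ∑ j ∈ Finset.range (N + M), toggleUp f g k m (j + 1) +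
      ∑ j ∈ Finset.range (N + M), k j =
      ∑ j ∈ Finset.range (N + M), max (f (j + 1)) (g (j + 1)) +
      ∑ j ∈ Finset.range (N + M), min (f j) (g j) := by
    rw [← Finset.sum_add_distrib, ← Finset.sum_add_distrib]
    refine Finset.sum_congr rfl fun j _ => ?_
    rw [toggleUp_succ]
    have := hf j; have := hg j; omega
  have h2 : ∑ j ∈ Finset.range (N + M), max (f (j + 1)) (g (j + 1)) + max (f 0) (g 0) =
      ∑ j ∈ Finset.range (N + M), max (f j) (g j) := by
    rw [← Finset.sum_range_succ' (fun j => max (f j) (g j)), Finset.sum_range_succ]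
    simp [hf0, hg0]
  have h3 : ∑ j ∈ Finset.range (N + M), max (f j) (g j) +
      ∑ j ∈ Finset.range (N + M), min (f j) (g j) =
      ∑ j ∈ Finset.range (N + M), f j + ∑ j ∈ Finset.range (N + M), g j := by
    rw [← Finset.sum_add_distrib, ← Finset.sum_add_distrib]
    exact Finset.sum_congr rfl fun j _ => by omega
  omega

open Classical in
/-- Summing `w ^ |n|` over all sequences `n` interlacing above two given ones. -/
theorem tsum_interlace_above (w : ENNReal) (f g : ℕ →₀ ℕ) :
    ∑' n : ℕ →₀ ℕ, (if Interlace n f ∧ Interlace n g then w ^ seqSize n else 0) =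
      (1 - w)⁻¹ * ∑' k : ℕ →₀ ℕ, if Interlace f k ∧ Interlace g k then
        w ^ (seqSize g - seqSize k) * w ^ seqSize f else 0 := by
  have key (p : (ℕ →₀ ℕ) → Prop) [DecidablePred p] (F : (ℕ →₀ ℕ) → ENNReal) :
      ∑' n, (if p n then F n else 0) = ∑' n : {n // p n}, F n.1 := by
    rw [show (∑' n : {n // p n}, F n.1) = ∑' n, {n | p n}.indicator F n from
      tsum_subtype {n | p n} F]
    simp [Set.indicator_apply]
  rw [key (fun n => Interlace n f ∧ Interlace n g),
    key (fun k => Interlace f k ∧ Interlace g k), ← (toggleEquiv f g).tsum_eq, ENNReal.tsum_prod', ← ENNReal.tsum_mul_left]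
  refine tsum_congr fun ⟨k, hf, hg⟩ => ?_
  rw [← ENNReal.tsum_geometric, ← ENNReal.tsum_mul_right]
  refine tsum_congr fun m => ?_
  rw [← pow_add, ← pow_add]
  congr 1
  have h := seqSize_toggleUp hf hg m
  have := hg.seqSize_le
  simp only [toggleEquiv, Equiv.coe_fn_mk]
  omega

open Classical in
/-- The generating function of chains of `N` interlacing sequences descending from `f` to `0`. -/
noncomputable def chainSum (x : ENNReal) : ℕ → (ℕ →₀ ℕ) → ENNReal
  | 0, f => if f = 0 then 1 else 0
  | N + 1, f => ∑' g, if Interlace f g then x ^ seqSize g * chainSum x N g else 0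

theorem chainSum_zero_right (x : ENNReal) (N : ℕ) : chainSum x N 0 = 1 := by
  induction N with
  | zero => simp [chainSum]
  | succ N ih =>
    simp only [chainSum, interlace_zero_left]
    rw [tsum_eq_single 0 (by intro b hb; simp [hb])]
    simp [ih]

open Classical in
theorem tsum_interlace_chainSum (x : ENNReal) (N : ℕ) (w : ENNReal) (f : ℕ →₀ ℕ) :
    ∑' n, (if Interlace n f then w ^ seqSize n * chainSum x N n else 0) =
      (∏ j ∈ Finset.range N, (1 - w * x ^ j)⁻¹) * (w ^ seqSize f * chainSum x N f) := by
  induction N generalizing w f with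
  | zero =>
    rw [tsum_eq_single 0 (by intro b hb; simp [hb, chainSum])]
    by_cases hf : f = 0 <;> simp [interlace_zero_left, hf, chainSum]
  | succ N ih =>
    have h1 : ∀ n, (if Interlace n f then w ^ seqSize n * chainSum x (N + 1) n else 0) =
        ∑' l, (x ^ seqSize l * chainSum x N l) *
          (if Interlace n l ∧ Interlace n f then w ^ seqSize n else 0) := by
      intro n
      simp only [chainSum]
      split_ifs with h
      · rw [← ENNReal.tsum_mul_left]
        refine tsum_congr fun l => ?_
        by_cases hl : Interlace n l <;> simp [h, hl, mul_comm]
      · simp [h]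
    have h2 : ∀ l, (∑' n, (x ^ seqSize l * chainSum x N l) *
          (if Interlace n l ∧ Interlace n f then w ^ seqSize n else 0)) =
        (1 - w)⁻¹ * ∑' k, (if Interlace f k then w ^ (seqSize f - seqSize k) else 0) *
          (if Interlace l k then (w * x) ^ seqSize l * chainSum x N l else 0) := by
      intro l
      rw [ENNReal.tsum_mul_left, tsum_interlace_above, mul_left_comm, ← ENNReal.tsum_mul_left]
      congr 1
      refine tsum_congr fun k => ?_
      by_cases hk : Interlace l k <;> by_cases hk' : Interlace f k <;>
        simp [hk, hk', mul_pow]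
      ring
    have h3 : ∀ k, (∑' l, (if Interlace f k then w ^ (seqSize f - seqSize k) else 0) *
          (if Interlace l k then (w * x) ^ seqSize l * chainSum x N l else 0)) =
        (∏ j ∈ Finset.range N, (1 - w * x ^ (j + 1))⁻¹) * (w ^ seqSize f *
          (if Interlace f k then x ^ seqSize k * chainSum x N k else 0)) := by
      intro k
      rw [ENNReal.tsum_mul_left, ih]
      split_ifs with h
      · have : w ^ seqSize f = w ^ (seqSize f - seqSize k) * w ^ seqSize k := by
          rw [← pow_add, Nat.sub_add_cancel h.seqSize_le]
        rw [this, mul_pow]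
        simp only [pow_succ', mul_assoc]
        ring
      · simp
    simp_rw [h1]
    rw [ENNReal.tsum_comm]
    simp_rw [h2]
    rw [ENNReal.tsum_mul_left, ENNReal.tsum_comm]
    simp_rw [h3]
    rw [ENNReal.tsum_mul_left, ENNReal.tsum_mul_left, Finset.prod_range_succ']
    simp only [chainSum, pow_zero, mul_one]
    ring

theorem tsum_chainSum_mul_chainSum (x : ENNReal) (M N : ℕ) (w : ENNReal) :
    ∑' f, w ^ seqSize f * (chainSum x M f * chainSum x N f) =
      ∏ i ∈ Finset.range M, ∏ j ∈ Finset.range N, (1 - w * x ^ (i + j))⁻¹ := by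
  classical
  induction M generalizing w with
  | zero =>
    rw [tsum_eq_single 0 (by intro b hb; simp [hb, chainSum])]
    simp [chainSum_zero_right]
  | succ M ih =>
    have h1 : ∀ f, w ^ seqSize f * (chainSum x (M + 1) f * chainSum x N f) =
        ∑' g, (x ^ seqSize g * chainSum x M g) *
          (if Interlace f g then w ^ seqSize f * chainSum x N f else 0) := by
      intro f
      simp only [chainSum]
      rw [mul_left_comm, ← ENNReal.tsum_mul_right]
      refine tsum_congr fun g => ?_
      split_ifs <;> simp
    simp_rw [h1]
    rw [ENNReal.tsum_comm]
    simp_rw [ENNReal.tsum_mul_left, tsum_interlace_chainSum]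
    rw [Finset.prod_range_succ', mul_comm]
    have h2 : ∀ g, x ^ seqSize g * chainSum x M g *
        ((∏ j ∈ Finset.range N, (1 - w * x ^ j)⁻¹) * (w ^ seqSize g * chainSum x N g)) =
        (∏ j ∈ Finset.range N, (1 - w * x ^ j)⁻¹) *
          ((w * x) ^ seqSize g * (chainSum x M g * chainSum x N g)) := by
      intro g
      rw [mul_pow]; ring
    simp_rw [h2]
    rw [ENNReal.tsum_mul_left, ih]
    simp only [zero_add, mul_assoc, ← pow_succ', add_right_comm]

/-- Chains of interlacing sequences that vanish from index `N` on. -/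
abbrev InterlacingChain (N : ℕ) : Type :=
  {a : ℕ → ℕ →₀ ℕ // (∀ d, Interlace (a d) (a (d + 1))) ∧ ∀ d, N ≤ d → a d = 0}

/-- Dropping the top of a chain. -/
noncomputable def chainTailEquiv (N : ℕ) (f : ℕ →₀ ℕ) :
    {a : InterlacingChain (N + 1) // a.1 0 = f} ≃
      {b : InterlacingChain N // Interlace f (b.1 0)} where
  toFun a := ⟨⟨fun d => a.1.1 (d + 1), fun d => a.1.2.1 (d + 1),
    fun d hd => a.1.2.2 (d + 1) (by omega)⟩, by have := a.1.2.1 0; rwa [a.2] at this⟩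
  invFun b := ⟨⟨fun d => Nat.casesOn d f fun e => b.1.1 e,
    by rintro (_ | d); exacts [b.2, b.1.2.1 d],
    by rintro (_ | d) hd; exacts [by omega, b.1.2.2 d (by omega)]⟩, rfl⟩
  left_inv := by
    rintro ⟨⟨a, h1, h2⟩, h3⟩
    refine Subtype.ext (Subtype.ext (funext ?_))
    rintro (_ | d)
    exacts [h3.symm, rfl]
  right_inv := by
    rintro ⟨⟨a, h1, h2⟩, h3⟩
    rfl

theorem tsum_ite_eq_tsum_subtype {α : Type*} (p : α → Prop) [DecidablePred p] (F : α → ENNReal) :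
    ∑' n, (if p n then F n else 0) = ∑' n : {n // p n}, F n.1 := by
  rw [show (∑' n : {n // p n}, F n.1) = ∑' n, {n | p n}.indicator F n from
    tsum_subtype {n | p n} F]
  simp [Set.indicator_apply]

open Classical in
theorem chainSum_eq_tsum (x : ENNReal) (N : ℕ) (f : ℕ →₀ ℕ) :
    chainSum x N f = ∑' a : InterlacingChain N,
      if a.1 0 = f then x ^ (∑ d ∈ Finset.range N, seqSize (a.1 (d + 1))) else 0 := by
  induction N generalizing f with
  | zero =>
    have hz : ∀ a : InterlacingChain 0, a.1 0 = 0 := fun a => a.2.2 0 le_rfl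
    let a0 : InterlacingChain 0 := ⟨fun _ => 0, fun d => by simp [interlace_zero_left], by simp⟩
    have hs : ∀ a : InterlacingChain 0, a = a0 := fun a =>
      Subtype.ext (funext fun d => a.2.2 d (by omega))
    rw [tsum_eq_single a0 (by intro b hb; exact absurd (hs b) hb)]
    simp only [chainSum, hz, eq_comm (a := f)]
    simp
  | succ N ih =>
    rw [tsum_ite_eq_tsum_subtype, ← (chainTailEquiv N f).symm.tsum_eq]
    simp only [chainSum]
    have h1 : ∀ g, (if Interlace f g then x ^ seqSize g * chainSum x N g else 0) =
        ∑' b : InterlacingChain N, if g = b.1 0 then (if Interlace f (b.1 0) then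
          x ^ (∑ d ∈ Finset.range (N + 1), seqSize (b.1 d)) else 0) else 0 := by
      intro g
      split_ifs with h
      · rw [ih, ← ENNReal.tsum_mul_left]
        refine tsum_congr fun b => ?_
        by_cases hb : b.1 0 = g
        · simp [hb, h, Finset.sum_range_succ', pow_add, mul_comm]
        · simp [hb, Ne.symm hb]
      · refine (ENNReal.tsum_eq_zero.2 fun b => ?_).symm
        by_cases hb : g = b.1 0
        · simp [← hb, h]
        · simp [hb]
    simp_rw [h1]
    rw [ENNReal.tsum_comm]
    simp_rw [tsum_ite_eq]
    rw [tsum_ite_eq_tsum_subtype (fun b : InterlacingChain N => Interlace f (b.1 0))]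
    rfl

/-- An array that is weakly decreasing along rows and columns. -/
def IsDecreasingArray (ω : ℕ → ℕ → ℕ) : Prop :=
  (∀ i j, ω (i + 1) j ≤ ω i j) ∧ ∀ i j, ω i (j + 1) ≤ ω i j

/-- Plane partitions with at most `N` rows and `N` columns. -/
abbrev BoxedPlanePartition (N : ℕ) : Type :=
  {ω : ℕ → ℕ → ℕ // IsDecreasingArray ω ∧ ∀ i j, N ≤ i ∨ N ≤ j → ω i j = 0}

theorem IsDecreasingArray.le_left {ω : ℕ → ℕ → ℕ} (h : IsDecreasingArray ω) (i j : ℕ) :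
    ω i j ≤ ω 0 j :=
  antitone_nat_of_succ_le (f := fun i => ω i j) (fun i => h.1 i j) (Nat.zero_le i)

theorem IsDecreasingArray.le_top {ω : ℕ → ℕ → ℕ} (h : IsDecreasingArray ω) (i j : ℕ) :
    ω i j ≤ ω i 0 :=
  antitone_nat_of_succ_le (f := fun j => ω i j) (fun j => h.2 i j) (Nat.zero_le j)

/-- The array with upper diagonals `a` and lower diagonals `b`. -/
def arrayOfDiagonals (a b : ℕ → ℕ →₀ ℕ) (i j : ℕ) : ℕ := if i ≤ j then a (j - i) i else b (i - j) j

theorem arrayOfDiagonals_upper (a b : ℕ → ℕ →₀ ℕ) (d i : ℕ) :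
    arrayOfDiagonals a b i (i + d) = a d i := by simp [arrayOfDiagonals]

theorem arrayOfDiagonals_lower {a b : ℕ → ℕ →₀ ℕ} (h : a 0 = b 0) (d j : ℕ) :
    arrayOfDiagonals a b (j + d) j = b d j := by
  rcases Nat.eq_zero_or_pos d with rfl | hd
  · simp [arrayOfDiagonals, h]
  · simp [arrayOfDiagonals, show ¬ j + d ≤ j by omega]

theorem isDecreasingArray_arrayOfDiagonals {a b : ℕ → ℕ →₀ ℕ} (h : a 0 = b 0)
    (ha : ∀ d, Interlace (a d) (a (d + 1))) (hb : ∀ d, Interlace (b d) (b (d + 1))) :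
    IsDecreasingArray (arrayOfDiagonals a b) := by
  constructor
  · intro i j
    rcases le_or_gt j i with hij | hij
    · obtain ⟨d, rfl⟩ := Nat.exists_eq_add_of_le hij
      rw [arrayOfDiagonals_lower h, add_assoc, arrayOfDiagonals_lower h]
      exact (hb d j).1
    · obtain ⟨d, rfl⟩ := Nat.exists_eq_add_of_le (Nat.succ_le_of_lt hij)
      rw [show i.succ + d = i + (d + 1) by omega, arrayOfDiagonals_upper,
        show i + (d + 1) = (i + 1) + d by omega, arrayOfDiagonals_upper]
      exact (ha d i).2
  · intro i j
    rcases le_or_gt i j with hij | hij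
    · obtain ⟨d, rfl⟩ := Nat.exists_eq_add_of_le hij
      rw [arrayOfDiagonals_upper, add_assoc, arrayOfDiagonals_upper]
      exact (ha d i).1
    · obtain ⟨d, rfl⟩ := Nat.exists_eq_add_of_le (Nat.succ_le_of_lt hij)
      rw [show j.succ + d = j + (d + 1) by omega, arrayOfDiagonals_lower h,
        show j + (d + 1) = (j + 1) + d by omega, arrayOfDiagonals_lower h]
      exact (hb d j).2

/-- A boxed plane partition amounts to a pair of chains with the same top. -/
noncomputable def boxedEquiv (N : ℕ) :
    {p : InterlacingChain N × InterlacingChain N // p.1.1 0 = p.2.1 0} ≃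
      BoxedPlanePartition N where
  toFun p := ⟨arrayOfDiagonals p.1.1.1 p.1.2.1,
    isDecreasingArray_arrayOfDiagonals p.2 p.1.1.2.1 p.1.2.2.1, by
    have h := isDecreasingArray_arrayOfDiagonals p.2 p.1.1.2.1 p.1.2.2.1
    intro i j hij
    refine Nat.le_zero.1 ?_
    rcases hij with hi | hj
    · refine (h.le_top i j).trans ?_
      have := arrayOfDiagonals_lower p.2 i 0
      rw [zero_add] at this
      simp [this, p.1.2.2.2 i hi]
    · refine (h.le_left i j).trans ?_
      have := arrayOfDiagonals_upper p.1.1.1 p.1.2.1 j 0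
      rw [zero_add] at this
      simp [this, p.1.1.2.2 j hj]⟩
  invFun ω := ⟨(⟨fun d => Finsupp.ofSupportFinite (fun i => ω.1 i (i + d))
      ((Set.finite_Iio N).subset fun i hi => by
        by_contra h
        exact hi (ω.2.2 _ _ (Or.inl (by simpa using h)))),
      fun d i => ⟨ω.2.1.2 i (i + d), by
        have := ω.2.1.1 i (i + 1 + d)
        simpa only [Finsupp.ofSupportFinite_coe, add_assoc, add_comm, add_left_comm] using this⟩,
      fun d hd => Finsupp.ext fun i => ω.2.2 _ _ (Or.inr (by omega))⟩,
    ⟨fun d => Finsupp.ofSupportFinite (fun j => ω.1 (j + d) j)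
      ((Set.finite_Iio N).subset fun i hi => by
        by_contra h
        exact hi (ω.2.2 _ _ (Or.inr (by simpa using h)))),
      fun d j => ⟨ω.2.1.1 (j + d) j, by
        have := ω.2.1.2 (j + 1 + d) j
        simpa only [Finsupp.ofSupportFinite_coe, add_assoc, add_comm, add_left_comm] using this⟩,
      fun d hd => Finsupp.ext fun i => ω.2.2 _ _ (Or.inl (by omega))⟩), rfl⟩
  left_inv := by
    rintro ⟨⟨⟨a, ha⟩, ⟨b, hb⟩⟩, h⟩
    refine Subtype.ext (Prod.ext (Subtype.ext (funext fun d => Finsupp.ext fun i => ?_))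
      (Subtype.ext (funext fun d => Finsupp.ext fun i => ?_)))
    · exact arrayOfDiagonals_upper a b d i
    · exact arrayOfDiagonals_lower h d i
  right_inv := by
    rintro ⟨ω, h⟩
    refine Subtype.ext (funext fun i => funext fun j => ?_)
    simp only [arrayOfDiagonals, Finsupp.ofSupportFinite_coe]
    split_ifs with hij
    · rw [Nat.add_sub_cancel' hij]
    · rw [Nat.add_sub_cancel' (by omega)]

/-- The cells of the quadrant, split into those on or above the diagonal and those below. -/
def diagonalEquiv : (ℕ × ℕ) ⊕ (ℕ × ℕ) ≃ ℕ × ℕ where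
  toFun := Sum.elim (fun p => (p.2, p.2 + p.1)) (fun p => (p.2 + (p.1 + 1), p.2))
  invFun p := if p.1 ≤ p.2 then Sum.inl (p.2 - p.1, p.1) else Sum.inr (p.1 - p.2 - 1, p.2)
  left_inv := by
    rintro (⟨d, i⟩ | ⟨d, i⟩)
    · simp
    · simp [show ¬ i + (d + 1) ≤ i by omega]
  right_inv := by
    rintro ⟨i, j⟩
    dsimp only
    split_ifs with h <;> simp <;> omega

theorem tsum_chain {a : ℕ → ℕ →₀ ℕ} {N : ℕ} (h : ∀ d, N ≤ d → a d = 0)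
    (hs : Summable fun p : ℕ × ℕ => a p.1 p.2) :
    ∑' p : ℕ × ℕ, a p.1 p.2 = ∑ d ∈ Finset.range N, seqSize (a d) := by
  have hf : ∀ d, Summable fun i => a d i := fun d =>
    summable_of_hasFiniteSupport (a d).hasFiniteSupport
  rw [hs.tsum_prod' (f := fun p : ℕ × ℕ => a p.1 p.2) hf, tsum_eq_sum (s := Finset.range N)]
  · rfl
  · intro d hd
    simp [h d (by simpa using hd)]

theorem tsum_arrayOfDiagonals {a b : ℕ → ℕ →₀ ℕ} {N : ℕ} (h : a 0 = b 0)
    (ha : ∀ d, N ≤ d → a d = 0) (hb : ∀ d, N ≤ d → b d = 0)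
    (hs : (Function.support fun q : ℕ × ℕ => arrayOfDiagonals a b q.1 q.2).Finite) :
    ∑' q : ℕ × ℕ, arrayOfDiagonals a b q.1 q.2 = seqSize (a 0) +
      (∑ d ∈ Finset.range N, seqSize (a (d + 1)) + ∑ d ∈ Finset.range N, seqSize (b (d + 1))) := by
  have hl : (fun q : ℕ × ℕ => arrayOfDiagonals a b (diagonalEquiv (Sum.inl q)).1
      (diagonalEquiv (Sum.inl q)).2) = fun q => a q.1 q.2 :=
    funext fun q => arrayOfDiagonals_upper a b q.1 q.2
  have hr : (fun q : ℕ × ℕ => arrayOfDiagonals a b (diagonalEquiv (Sum.inr q)).1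
      (diagonalEquiv (Sum.inr q)).2) = fun q => b (q.1 + 1) q.2 :=
    funext fun q => arrayOfDiagonals_lower h (q.1 + 1) q.2
  have hsl : Summable fun q : ℕ × ℕ => a q.1 q.2 := by
    rw [← hl]
    exact summable_of_hasFiniteSupport
      (hs.preimage (diagonalEquiv.injective.comp Sum.inl_injective).injOn)
  have hsr : Summable fun q : ℕ × ℕ => b (q.1 + 1) q.2 := by
    rw [← hr]
    exact summable_of_hasFiniteSupport
      (hs.preimage (diagonalEquiv.injective.comp Sum.inr_injective).injOn)
  have e1 : ∑' q : ℕ × ℕ, arrayOfDiagonals a b q.1 q.2 =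
      ∑' q : ℕ × ℕ, a q.1 q.2 + ∑' q : ℕ × ℕ, b (q.1 + 1) q.2 := by
    rw [← diagonalEquiv.tsum_eq, Summable.tsum_sum (by rw [← hl] at hsl; exact hsl)
      (by rw [← hr] at hsr; exact hsr),
      hl, hr]
  have e2 := tsum_chain (a := a) (N := N + 1) (fun d hd => ha d (by omega)) hsl
  have e3 := tsum_chain (a := fun d => b (d + 1)) (N := N) (fun d hd => hb _ (by omega)) hsr
  rw [e1, e2, e3, Finset.sum_range_succ']
  ring

theorem tsum_boxedEquiv {N : ℕ}
    (p : {p : InterlacingChain N × InterlacingChain N // p.1.1 0 = p.2.1 0}) :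
    ∑' q : ℕ × ℕ, (boxedEquiv N p).1 q.1 q.2 = seqSize (p.1.1.1 0) +
      (∑ d ∈ Finset.range N, seqSize (p.1.1.1 (d + 1)) +
        ∑ d ∈ Finset.range N, seqSize (p.1.2.1 (d + 1))) := by
  refine tsum_arrayOfDiagonals p.2 p.1.1.2.2 p.1.2.2.2 ?_
  refine ((Set.finite_Iio N).prod (Set.finite_Iio N)).subset fun q hq => ?_
  by_contra h
  refine hq ((boxedEquiv N p).2.2 _ _ ?_)
  simp only [Set.mem_prod, Set.mem_Iio] at h
  omega

/-- MacMahon's formula for plane partitions in a box. -/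
theorem tsum_boxedPlanePartition (x : ENNReal) (N : ℕ) :
    ∑' ω : BoxedPlanePartition N, x ^ (∑' q : ℕ × ℕ, ω.1 q.1 q.2) =
      ∏ i ∈ Finset.range N, ∏ j ∈ Finset.range N, (1 - x ^ (i + j + 1))⁻¹ := by
  classical
  have h0 := tsum_chainSum_mul_chainSum x N N x
  simp only [← pow_succ'] at h0
  rw [← h0, ← (boxedEquiv N).tsum_eq]
  simp_rw [tsum_boxedEquiv]
  rw [← tsum_ite_eq_tsum_subtype (fun p : InterlacingChain N × InterlacingChain N =>
    p.1.1 0 = p.2.1 0) (fun p => x ^ (seqSize (p.1.1 0) +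
      (∑ d ∈ Finset.range N, seqSize (p.1.1 (d + 1)) +
        ∑ d ∈ Finset.range N, seqSize (p.2.1 (d + 1))))), ENNReal.tsum_prod']
  have h1 : ∀ f, x ^ seqSize f * (chainSum x N f * chainSum x N f) =
      ∑' a : InterlacingChain N, if f = a.1 0 then ∑' b : InterlacingChain N,
        (if a.1 0 = b.1 0 then x ^ (seqSize (a.1 0) +
        (∑ d ∈ Finset.range N, seqSize (a.1 (d + 1)) +
        ∑ d ∈ Finset.range N, seqSize (b.1 (d + 1)))) else 0) else 0 := by
    intro f
    rw [chainSum_eq_tsum, ← ENNReal.tsum_mul_right, ← ENNReal.tsum_mul_left]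
    refine tsum_congr fun a => ?_
    by_cases ha : f = a.1 0
    · subst ha
      simp only [if_true]
      rw [← ENNReal.tsum_mul_left, ← ENNReal.tsum_mul_left]
      refine tsum_congr fun b => ?_
      by_cases hb : a.1 0 = b.1 0
      · simp [hb, pow_add]
      · simp [hb, Ne.symm hb]
    · simp [ha, Ne.symm ha]
  simp_rw [h1]
  rw [ENNReal.tsum_comm (α := ℕ →₀ ℕ)]
  simp_rw [tsum_ite_eq]

/-- Plane partitions of arbitrary size. -/
abbrev PlanePartition : Type :=
  {ω : ℕ → ℕ → ℕ // IsDecreasingArray ω ∧ ∃ N, ∀ i j, N ≤ i ∨ N ≤ j → ω i j = 0}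

/-- The sum of the entries of a plane partition. -/
noncomputable def ppSize (ω : PlanePartition) : ℕ := ∑' q : ℕ × ℕ, ω.1 q.1 q.2

/-- The number of plane partitions of size `n`. -/
noncomputable def ppCount (n : ℕ) : ℕ := Nat.card (ppSize ⁻¹' {n})

theorem summable_weight (p : ℕ) {r : ℝ} (h0 : 0 ≤ r) (h1 : r < 1) :
    Summable fun q : ℕ × ℕ => ((q.1 + 1 : ℝ) / (q.2 + 1)) *
      ((q.1 + 1 : ℝ) * (q.2 + 1)) ^ p * r ^ ((q.1 + 1) * (q.2 + 1)) := by
  obtain ⟨ρ, hr, hρ⟩ := exists_between h1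
  have hρ0 : 0 < ρ := h0.trans_lt hr
  have ht : Tendsto (fun n : ℕ => (n : ℝ) ^ (p + 1) * (r / ρ) ^ n) atTop (nhds 0) :=
    tendsto_pow_const_mul_const_pow_of_abs_lt_one _ (by
      rw [abs_of_nonneg (by positivity), div_lt_one hρ0]; exact hr)
  obtain ⟨C, hC⟩ := ht.bddAbove_range
  have hC' : ∀ n : ℕ, (n : ℝ) ^ (p + 1) * r ^ n ≤ C * ρ ^ n := by
    intro n
    have := hC ⟨n, rfl⟩
    simp only at this
    rw [div_pow, ← mul_div_assoc, div_le_iff₀ (by positivity)] at this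
    exact this
  have hC0 : 0 ≤ C := le_trans (by positivity) (hC ⟨0, rfl⟩)
  have hg := summable_geometric_of_lt_one hρ0.le hρ
  refine Summable.of_nonneg_of_le (fun q => by positivity) (fun q => ?_)
    ((hg.mul_of_nonneg hg (fun _ => by positivity) (fun _ => by positivity)).mul_left C)
  have e : ((q.1 + 1 : ℝ) / (q.2 + 1)) * ((q.1 + 1 : ℝ) * (q.2 + 1)) ^ p ≤
      (((q.1 + 1) * (q.2 + 1) : ℕ) : ℝ) ^ (p + 1) := by
    rw [pow_succ']
    push_cast
    gcongr
    rw [div_le_iff₀ (by positivity)]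
    have : (0 : ℝ) ≤ q.1 := by positivity
    have : (0 : ℝ) ≤ q.2 := by positivity
    have : (0 : ℝ) ≤ q.1 * q.2 := by positivity
    have : (0 : ℝ) ≤ q.1 * q.2 * q.2 := by positivity
    nlinarith
  calc _ ≤ (((q.1 + 1) * (q.2 + 1) : ℕ) : ℝ) ^ (p + 1) * r ^ ((q.1 + 1) * (q.2 + 1)) := by gcongr
    _ ≤ C * ρ ^ ((q.1 + 1) * (q.2 + 1)) := hC' _
    _ ≤ C * (ρ ^ q.1 * ρ ^ q.2) := by
      rw [← pow_add]
      exact mul_le_mul_of_nonneg_left (pow_le_pow_of_le_one hρ0.le hρ.le (by nlinarith)) hC0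

theorem hasSum_neg_log_quadrant {x : ℝ} (h0 : 0 ≤ x) (h1 : x < 1) :
    HasSum (fun q : ℕ × ℕ => -Real.log (1 - x ^ (q.1 + q.2 + 1)))
      (∑' q : ℕ × ℕ, ((q.1 + 1 : ℝ) / (q.2 + 1)) * x ^ ((q.1 + 1) * (q.2 + 1))) := by
  have hw : Summable fun q : ℕ × ℕ => ((q.1 + 1 : ℝ) / (q.2 + 1)) * x ^ ((q.1 + 1) * (q.2 + 1)) := by
    simpa using summable_weight 0 h0 h1
  have hL : ∀ k : ℕ, HasSum (fun m : ℕ => (x ^ (k + 1)) ^ (m + 1) / (m + 1 : ℝ))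
      (-Real.log (1 - x ^ (k + 1))) := fun k => by
    refine Real.hasSum_pow_div_log_of_abs_lt_one ?_
    rw [abs_of_nonneg (by positivity)]
    exact pow_lt_one₀ h0 h1 (by omega)
  have hL0 : ∀ k : ℕ, 0 ≤ -Real.log (1 - x ^ (k + 1)) := fun k =>
    (hL k).nonneg fun m => by positivity
  have key : ∑' q : ℕ × ℕ, ENNReal.ofReal (-Real.log (1 - x ^ (q.1 + q.2 + 1))) =
      ENNReal.ofReal
        (∑' q : ℕ × ℕ, ((q.1 + 1 : ℝ) / (q.2 + 1)) * x ^ ((q.1 + 1) * (q.2 + 1))) := by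
    have hdiag : ∑' q : ℕ × ℕ, ENNReal.ofReal (-Real.log (1 - x ^ (q.1 + q.2 + 1))) =
        ∑' (k : ℕ) (_ : Finset.HasAntidiagonal.antidiagonal k), ENNReal.ofReal (-Real.log (1 - x ^ (k + 1))) := by
      rw [← Finset.HasAntidiagonal.sigmaAntidiagonalEquivProd.tsum_eq, ENNReal.tsum_sigma']
      refine tsum_congr fun k => tsum_congr fun p => ?_
      exact congrArg (fun j => ENNReal.ofReal (-Real.log (1 - x ^ (j + 1))))
        (Finset.HasAntidiagonal.mem_antidiagonal.1 p.2)
    rw [hdiag, ENNReal.ofReal_tsum_of_nonneg (fun q => by positivity) hw, ENNReal.tsum_prod']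
    refine tsum_congr fun k => ?_
    have e : ∀ m : ℕ, ENNReal.ofReal ((k + 1 : ℝ) / (m + 1) * x ^ ((k + 1) * (m + 1))) =
        (k + 1) * ENNReal.ofReal ((x ^ (k + 1)) ^ (m + 1) / (m + 1 : ℝ)) := fun m => by
      rw [← pow_mul, div_mul_eq_mul_div, mul_div_assoc, ENNReal.ofReal_mul (by positivity)]
      congr 1
      rw [ENNReal.ofReal_add (by positivity) (by positivity)]
      simp
    simp_rw [e]
    rw [ENNReal.tsum_mul_left, ← ENNReal.ofReal_tsum_of_nonneg (fun m => by positivity)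
      (hL k).summable, (hL k).tsum_eq, tsum_fintype]
    simp
  have hs : Summable fun q : ℕ × ℕ => -Real.log (1 - x ^ (q.1 + q.2 + 1)) := by
    have := ENNReal.summable_toReal (key ▸ ENNReal.ofReal_ne_top)
    simpa only [ENNReal.toReal_ofReal (hL0 _)] using this
  rw [hs.hasSum_iff]
  rw [← ENNReal.ofReal_tsum_of_nonneg (fun q => hL0 _) hs,
    ENNReal.ofReal_eq_ofReal_iff (tsum_nonneg fun q => hL0 _)
      (tsum_nonneg fun q => by positivity)] at key
  exact key

theorem tsum_planePartition_eq_iSup (x : ENNReal) :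
    ∑' ω : PlanePartition, x ^ ppSize ω =
      ⨆ N, ∑' ω : BoxedPlanePartition N, x ^ (∑' q : ℕ × ℕ, ω.1 q.1 q.2) := by
  apply le_antisymm
  · rw [ENNReal.tsum_eq_iSup_sum]
    refine iSup_le fun s => ?_
    choose B hB using fun ω : PlanePartition => ω.2.2
    refine le_iSup_of_le (s.sup B) ?_
    let φ : s → BoxedPlanePartition (s.sup B) := fun ω => ⟨ω.1.1, ω.1.2.1, fun i j h =>
      hB ω.1 i j (by have := Finset.le_sup (f := B) ω.2; omega)⟩
    have hφ : Function.Injective φ := fun a b h =>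
      Subtype.ext (Subtype.ext (congrArg (fun ω => ω.1) h))
    calc ∑ ω ∈ s, x ^ ppSize ω = ∑' ω : s, x ^ ppSize ω := (Finset.tsum_subtype s _).symm
      _ = ∑' ω : s, (fun ω : BoxedPlanePartition (s.sup B) =>
          x ^ (∑' q : ℕ × ℕ, ω.1 q.1 q.2)) (φ ω) := rfl
      _ ≤ _ := ENNReal.tsum_comp_le_tsum_of_injective hφ _
  · refine iSup_le fun N => ?_
    let φ : BoxedPlanePartition N → PlanePartition := fun ω => ⟨ω.1, ω.2.1, N, ω.2.2⟩
    have hφ : Function.Injective φ := fun a b h => Subtype.ext (congrArg (fun ω => ω.1) h)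
    exact ENNReal.tsum_comp_le_tsum_of_injective hφ fun ω => x ^ ppSize ω

/-- MacMahon's generating function for plane partitions. -/
theorem tsum_planePartition {x : ℝ} (h0 : 0 ≤ x) (h1 : x < 1) :
    ∑' ω : PlanePartition, ENNReal.ofReal x ^ ppSize ω = ENNReal.ofReal (Real.exp
      (∑' q : ℕ × ℕ, ((q.1 + 1 : ℝ) / (q.2 + 1)) * x ^ ((q.1 + 1) * (q.2 + 1)))) := by
  have hb : ∀ N : ℕ, ∑' ω : BoxedPlanePartition N,
      ENNReal.ofReal x ^ (∑' q : ℕ × ℕ, ω.1 q.1 q.2) = ENNReal.ofReal (Real.exp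
        (∑ q ∈ Finset.range N ×ˢ Finset.range N, -Real.log (1 - x ^ (q.1 + q.2 + 1)))) := by
    intro N
    rw [tsum_boxedPlanePartition, ← Finset.prod_product', Real.exp_sum,
      ENNReal.ofReal_prod_of_nonneg fun _ _ => (Real.exp_pos _).le]
    refine Finset.prod_congr rfl fun q _ => ?_
    have hq : x ^ (q.1 + q.2 + 1) < 1 := pow_lt_one₀ h0 h1 (by omega)
    rw [Real.exp_neg, Real.exp_log (by linarith), ENNReal.ofReal_inv_of_pos (by linarith),
      ENNReal.ofReal_sub _ (by positivity), ENNReal.ofReal_one, ENNReal.ofReal_pow h0]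
  have hmono : Monotone fun N : ℕ => Finset.range N ×ˢ Finset.range N := fun a b hab =>
    Finset.product_subset_product (Finset.range_mono hab) (Finset.range_mono hab)
  have hlim : Tendsto (fun N : ℕ => ∑' ω : BoxedPlanePartition N,
      ENNReal.ofReal x ^ (∑' q : ℕ × ℕ, ω.1 q.1 q.2)) atTop (nhds (ENNReal.ofReal (Real.exp
      (∑' q : ℕ × ℕ, ((q.1 + 1 : ℝ) / (q.2 + 1)) * x ^ ((q.1 + 1) * (q.2 + 1)))))) := by
    simp_rw [hb]
    refine ENNReal.tendsto_ofReal ((Real.continuous_exp.tendsto _).comp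
      ((hasSum_neg_log_quadrant h0 h1).comp (tendsto_atTop_finset_of_monotone hmono fun q =>
        ⟨q.1 + q.2 + 1, ?_⟩)))
    simp only [Finset.mem_product, Finset.mem_range]
    omega
  rw [tsum_planePartition_eq_iSup]
  refine tendsto_nhds_unique (tendsto_atTop_iSup ?_) hlim
  intro M N hMN
  let φ : BoxedPlanePartition M → BoxedPlanePartition N := fun ω =>
    ⟨ω.1, ω.2.1, fun i j h => ω.2.2 i j (by omega)⟩
  have hφ : Function.Injective φ := fun a b h =>
    Subtype.ext (congrArg (fun ω => ω.1) h)
  exact ENNReal.tsum_comp_le_tsum_of_injective hφ fun ω : BoxedPlanePartition N =>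
    ENNReal.ofReal x ^ (∑' q : ℕ × ℕ, ω.1 q.1 q.2)

theorem finite_ppSize_fiber (n : ℕ) : Finite (ppSize ⁻¹' {n}) := by
  by_contra h
  rw [not_finite_iff_infinite] at h
  have h1 : ∑' ω : ppSize ⁻¹' {n}, ENNReal.ofReal 2⁻¹ ^ ppSize ω.1 = ⊤ := by
    rw [tsum_congr (g := fun _ => ENNReal.ofReal 2⁻¹ ^ n) fun ω => by rw [ω.2]]
    exact ENNReal.tsum_const_eq_top_of_ne_zero (by positivity)
  have h2 : ∑' ω : ppSize ⁻¹' {n}, ENNReal.ofReal 2⁻¹ ^ ppSize ω.1 ≤ _ :=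
    ENNReal.tsum_comp_le_tsum_of_injective Subtype.val_injective
      fun ω => ENNReal.ofReal 2⁻¹ ^ ppSize ω
  rw [h1, tsum_planePartition (by norm_num) (by norm_num)] at h2
  exact ENNReal.ofReal_ne_top (top_le_iff.1 h2)

theorem hasSum_ppCount {x : ℝ} (h0 : 0 ≤ x) (h1 : x < 1) :
    HasSum (fun n => (ppCount n : ℝ) * x ^ n) (Real.exp
      (∑' q : ℕ × ℕ, ((q.1 + 1 : ℝ) / (q.2 + 1)) * x ^ ((q.1 + 1) * (q.2 + 1)))) := by
  have h := tsum_planePartition h0 h1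
  rw [← ENNReal.tsum_fiberwise _ ppSize] at h
  have e : ∀ n, ∑' ω : ppSize ⁻¹' {n}, ENNReal.ofReal x ^ ppSize ω.1 =
      ENNReal.ofReal ((ppCount n : ℝ) * x ^ n) := by
    intro n
    have := finite_ppSize_fiber n
    have := Fintype.ofFinite (ppSize ⁻¹' {n})
    rw [tsum_congr (g := fun _ => ENNReal.ofReal x ^ n) fun ω => by rw [ω.2], tsum_fintype,
      ppCount, Nat.card_eq_fintype_card, ENNReal.ofReal_mul (by positivity),
      ENNReal.ofReal_pow h0]
    simp
  simp_rw [e] at h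
  have hs : Summable fun n => (ppCount n : ℝ) * x ^ n := by
    have := ENNReal.summable_toReal (h ▸ ENNReal.ofReal_ne_top)
    refine this.congr fun n => ?_
    rw [ENNReal.toReal_ofReal (by positivity)]
  rw [hs.hasSum_iff]
  rwa [← ENNReal.ofReal_tsum_of_nonneg (fun q => by positivity) hs,
    ENNReal.ofReal_eq_ofReal_iff (tsum_nonneg fun q => by positivity) (Real.exp_pos _).le] at h

theorem finite_support_of_summable_nat {α : Type*} {f : α → ℕ} (h : Summable f) :
    (Function.support f).Finite := by
  have h1 : Summable fun a => (f a : ℝ) := h.map (Nat.castAddMonoidHom ℝ) continuous_of_discreteTopology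
  have h2 := h1.tendsto_cofinite_zero.eventually (gt_mem_nhds (zero_lt_one (α := ℝ)))
  refine Set.Finite.subset h2 fun a ha hlt => ?_
  have h3 : (1 : ℝ) ≤ f a := by exact_mod_cast Nat.one_le_iff_ne_zero.2 ha
  exact absurd h3 (not_le.2 hlt)

theorem planePartitionCount_eq {n : ℕ} (hn : n ≠ 0) : planePartitionCount n = ppCount n := by
  refine Nat.card_congr
    { toFun := fun ω => ⟨⟨ω.1, ⟨ω.2.1, ω.2.2.1⟩, ?_⟩, ω.2.2.2⟩
      invFun := fun ω => ⟨ω.1.1, ω.1.2.1.1, ω.1.2.1.2, ω.2⟩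
      left_inv := fun ω => rfl
      right_inv := fun ω => rfl }
  obtain ⟨ω, h1, h2, h3⟩ := ω
  have hs : Summable fun p : ℕ × ℕ => ω p.1 p.2 := by
    by_contra h
    exact hn (h3 ▸ tsum_eq_zero_of_not_summable h)
  have hf := finite_support_of_summable_nat hs
  refine ⟨hf.toFinset.sup (fun p => p.1 + p.2) + 1, fun i j hij => ?_⟩
  by_contra h
  have := Finset.le_sup (f := fun p : ℕ × ℕ => p.1 + p.2) 
    (show (i, j) ∈ hf.toFinset from hf.mem_toFinset.2 h)
  simp only at this
  omega

theorem differentiableOn_tsum_mul_pow {ι : Type*} {w : ι → ℝ} {e : ι → ℕ} (hw : ∀ i, 0 ≤ w i)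
    (h : ∀ r : ℝ, 0 ≤ r → r < 1 → Summable fun i => w i * r ^ e i) :
    DifferentiableOn ℂ (fun z : ℂ => ∑' i, (w i : ℂ) * z ^ e i) (Metric.ball 0 1) := by
  intro z hz
  rw [mem_ball_zero_iff] at hz
  obtain ⟨ρ, h1, h2⟩ := exists_between hz
  have h0 : 0 ≤ ρ := (norm_nonneg z).trans h1.le
  have hd : DifferentiableOn ℂ (fun z : ℂ => ∑' i, (w i : ℂ) * z ^ e i) (Metric.ball 0 ρ) := by
    refine Complex.differentiableOn_tsum_of_summable_norm (h ρ h0 h2) (fun i => by fun_prop)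
      Metric.isOpen_ball fun i x hx => ?_
    rw [mem_ball_zero_iff] at hx
    rw [norm_mul, norm_pow, Complex.norm_real, Real.norm_of_nonneg (hw i)]
    exact mul_le_mul_of_nonneg_left (pow_le_pow_left₀ (norm_nonneg _) hx.le _) (hw i)
  exact (hd.differentiableAt (Metric.isOpen_ball.mem_nhds (by simpa using h1))).differentiableWithinAt

theorem tsum_ppCount_mul_pow {z : ℂ} (hz : ‖z‖ < 1) :
    ∑' n, (ppCount n : ℂ) * z ^ n = Complex.exp (∑' q : ℕ × ℕ,
      (((q.1 + 1 : ℝ) / (q.2 + 1) : ℝ) : ℂ) * z ^ ((q.1 + 1) * (q.2 + 1))) := by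
  have hf := (differentiableOn_tsum_mul_pow (w := fun n => (ppCount n : ℝ)) (e := id)
    (fun n => by positivity) fun r h0 h1 => (hasSum_ppCount h0 h1).summable).analyticOnNhd
      Metric.isOpen_ball
  have hg := (differentiableOn_tsum_mul_pow (w := fun q : ℕ × ℕ => (q.1 + 1 : ℝ) / (q.2 + 1))
    (e := fun q => (q.1 + 1) * (q.2 + 1)) (fun n => by positivity)
    fun r h0 h1 => by simpa using summable_weight 0 h0 h1).cexp.analyticOnNhd Metric.isOpen_ball
  have hreal : ∀ x : ℝ, 0 ≤ x → x < 1 → ∑' n, (ppCount n : ℂ) * (x : ℂ) ^ n =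
      Complex.exp (∑' q : ℕ × ℕ,
        (((q.1 + 1 : ℝ) / (q.2 + 1) : ℝ) : ℂ) * (x : ℂ) ^ ((q.1 + 1) * (q.2 + 1))) := by
    intro x h0 h1
    have := congrArg (fun t : ℝ => (t : ℂ)) (hasSum_ppCount h0 h1).tsum_eq
    simpa only [Complex.ofReal_tsum, Complex.ofReal_mul, Complex.ofReal_pow, Complex.ofReal_exp,
      Complex.ofReal_natCast] using this
  have hfreq : ∃ᶠ z : ℂ in nhdsWithin 0 {0}ᶜ, ∑' n, (((ppCount n : ℝ)) : ℂ) * z ^ (id n) =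
      Complex.exp (∑' q : ℕ × ℕ,
      (((q.1 + 1 : ℝ) / (q.2 + 1) : ℝ) : ℂ) * z ^ ((q.1 + 1) * (q.2 + 1))) := by
    have ht : Tendsto (fun x : ℝ => (x : ℂ)) (nhdsWithin 0 (Set.Ioi 0)) (nhdsWithin 0 {0}ᶜ) := by
      refine tendsto_nhdsWithin_iff.2 ⟨?_, ?_⟩
      · exact (Complex.continuous_ofReal.tendsto' 0 0 (by simp)).mono_left nhdsWithin_le_nhds
      · filter_upwards [self_mem_nhdsWithin] with x hx
        simpa using (Set.mem_Ioi.1 hx).ne'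
    refine ht.frequently (Eventually.frequently ?_)
    filter_upwards [Ioo_mem_nhdsGT (zero_lt_one (α := ℝ))] with x hx
    simpa using hreal x hx.1.le hx.2
  have := hf.eqOn_of_preconnected_of_frequently_eq hg
    (convex_ball _ _).isPreconnected (Metric.mem_ball_self one_pos) hfreq
    (mem_ball_zero_iff.2 hz)
  simpa using this

theorem integral_exp_int_mul (k : ℤ) :
    ∫ θ in (-π)..π, Complex.exp (k * Complex.I * θ) = if k = 0 then 2 * (π : ℂ) else 0 := by
  split_ifs with hk
  · simp [hk]; ring
  · rw [integral_exp_mul_complex (by simp [hk])]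
    have : Complex.exp (k * Complex.I * (π : ℝ)) = Complex.exp (k * Complex.I * (-π : ℝ)) := by
      rw [Complex.exp_eq_exp_iff_exists_int]
      exact ⟨k, by push_cast; ring⟩
    rw [this, sub_self, zero_div]

/-- Cauchy's integral formula for the coefficients of a power series with non-negative
coefficients, on a circle of radius less than one. -/
theorem integral_tsum_mul_exp {c : ℕ → ℝ} (hc : ∀ n, 0 ≤ c n) {r : ℝ} (h0 : 0 ≤ r)
    (hs : Summable fun n => c n * r ^ n) (n : ℕ) :
    ∫ θ in (-π)..π, (∑' m, (c m : ℂ) * (r * Complex.exp (Complex.I * θ)) ^ m) *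
      Complex.exp (-(Complex.I * n * θ)) = 2 * π * (c n * r ^ n) := by
  have e : ∀ (m : ℕ) (θ : ℝ), (c m : ℂ) * (r * Complex.exp (Complex.I * θ)) ^ m *
      Complex.exp (-(Complex.I * n * θ)) =
      (c m * r ^ m) * Complex.exp (((m - n : ℤ) : ℂ) * Complex.I * θ) := by
    intro m θ
    rw [mul_pow, ← Complex.exp_nat_mul, mul_assoc, mul_assoc, ← Complex.exp_add, ← mul_assoc]
    congr 2
    push_cast
    ring
  have h := intervalIntegral.hasSum_intervalIntegral_of_summable_norm (a := -π) (b := π)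
    (f := fun m => (⟨fun θ : ℝ => (c m * r ^ m) *
      Complex.exp (((m - n : ℤ) : ℂ) * Complex.I * θ), by fun_prop⟩ : C(ℝ, ℂ))) ?_
  · simp only [ContinuousMap.coe_mk] at h
    simp_rw [← tsum_mul_right, e]
    rw [← h.tsum_eq, tsum_eq_single n]
    · rw [intervalIntegral.integral_const_mul, integral_exp_int_mul]
      simp; ring
    · intro m hm
      rw [intervalIntegral.integral_const_mul, integral_exp_int_mul, if_neg (by omega), mul_zero]
  · refine hs.of_nonneg_of_le (fun _ => norm_nonneg _) fun m => ?_
    refine (ContinuousMap.norm_le _ (by have := hc m; positivity)).2 fun θ => ?_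
    simp [Complex.norm_exp, abs_of_nonneg (hc m), abs_of_nonneg h0]

/-- The weight of a pair `(k, m)` in the logarithm of MacMahon's generating function. -/
noncomputable def pairWeight (q : ℕ × ℕ) : ℝ := (q.1 + 1 : ℝ) / (q.2 + 1)

/-- The exponent of a pair `(k, m)` in the logarithm of MacMahon's generating function. -/
def pairDegree (q : ℕ × ℕ) : ℕ := (q.1 + 1) * (q.2 + 1)

/-- The `p`-th derivative, up to sign, of the logarithm of MacMahon's generating function at
`exp (-s)` with respect to `s`. -/
noncomputable def logMoment (p : ℕ) (s : ℝ) : ℝ :=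
  ∑' q : ℕ × ℕ, pairWeight q * (pairDegree q : ℝ) ^ p * Real.exp (-s) ^ pairDegree q

theorem pairWeight_pos (q : ℕ × ℕ) : 0 < pairWeight q := by unfold pairWeight; positivity

theorem summable_logMoment (p : ℕ) {s : ℝ} (hs : 0 < s) : Summable fun q : ℕ × ℕ =>
    pairWeight q * (pairDegree q : ℝ) ^ p * Real.exp (-s) ^ pairDegree q := by
  simpa [pairWeight, pairDegree] using
    summable_weight p (Real.exp_pos (-s)).le (Real.exp_lt_one_iff.2 (neg_lt_zero.2 hs))

/-- The normalised exponent in Cauchy's formula for the number of plane partitions of `n`. -/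
noncomputable def circleExponent (n : ℕ) (s θ : ℝ) : ℂ :=
  ∑' q : ℕ × ℕ, ((pairWeight q * Real.exp (-s) ^ pairDegree q : ℝ) : ℂ) *
    (Complex.exp (Complex.I * pairDegree q * θ) - 1) - Complex.I * n * θ

theorem summable_pairWeight_mul_exp {s : ℝ} (hs : 0 < s) (θ : ℝ) : Summable fun q : ℕ × ℕ =>
    ((pairWeight q * Real.exp (-s) ^ pairDegree q : ℝ) : ℂ) *
      Complex.exp (Complex.I * pairDegree q * θ) := by
  refine Summable.of_norm_bounded (summable_logMoment 0 hs) fun q => ?_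
  have := pairWeight_pos q
  rw [norm_mul, Complex.norm_real, Real.norm_of_nonneg (by positivity), Complex.norm_exp]
  simp

theorem integral_exp_circleExponent (n : ℕ) {s : ℝ} (hs : 0 < s) :
    ∫ θ in (-π)..π, Complex.exp (circleExponent n s θ) =
      ((2 * π * (ppCount n * Real.exp (-(n * s)) * Real.exp (-logMoment 0 s)) : ℝ) : ℂ) := by
  have hr1 : Real.exp (-s) < 1 := Real.exp_lt_one_iff.2 (neg_lt_zero.2 hs)
  have h := integral_tsum_mul_exp (c := fun n => (ppCount n : ℝ)) (fun n => by positivity)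
    (Real.exp_pos (-s)).le (hasSum_ppCount (Real.exp_pos (-s)).le hr1).summable n
  have e : ∀ θ : ℝ, Complex.exp (circleExponent n s θ) =
      Complex.exp (-(logMoment 0 s : ℝ)) * ((∑' m, (((ppCount m : ℝ)) : ℂ) *
        ((Real.exp (-s) : ℝ) * Complex.exp (Complex.I * θ)) ^ m) *
      Complex.exp (-(Complex.I * n * θ))) := by
    intro θ
    have hz : ‖((Real.exp (-s) : ℝ) : ℂ) * Complex.exp (Complex.I * θ)‖ < 1 := by
      rw [norm_mul, Complex.norm_exp, Complex.norm_real, Real.norm_of_nonneg (Real.exp_pos _).le]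
      simpa using hs
    have h2 := tsum_ppCount_mul_pow hz
    simp only [Complex.ofReal_natCast]
    rw [h2, ← Complex.exp_add, ← Complex.exp_add]
    congr 1
    rw [circleExponent]
    have e1 : ∀ q : ℕ × ℕ, (((q.1 + 1 : ℝ) / (q.2 + 1) : ℝ) : ℂ) * (((Real.exp (-s) : ℝ) : ℂ) *
        Complex.exp (Complex.I * θ)) ^ ((q.1 + 1) * (q.2 + 1)) =
        ((pairWeight q * Real.exp (-s) ^ pairDegree q : ℝ) : ℂ) *
      Complex.exp (Complex.I * pairDegree q * θ) := fun q => by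
      rw [mul_pow, ← Complex.exp_nat_mul, pairWeight, pairDegree]
      push_cast
      rw [← mul_assoc]
      congr 2
      ring
    have e2 : ((logMoment 0 s : ℝ) : ℂ) = ∑' q : ℕ × ℕ,
        ((pairWeight q * Real.exp (-s) ^ pairDegree q : ℝ) : ℂ) := by
      rw [← Complex.ofReal_tsum, logMoment]
      simp
    have hA : Summable fun q : ℕ × ℕ => 
        ((pairWeight q * Real.exp (-s) ^ pairDegree q : ℝ) : ℂ) := by
      simpa using summable_pairWeight_mul_exp hs 0
    simp_rw [e1, mul_sub, mul_one]
    rw [(summable_pairWeight_mul_exp hs θ).tsum_sub hA, ← e2]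
    push_cast
    ring
  simp_rw [e, intervalIntegral.integral_const_mul]
  rw [h]
  push_cast
  rw [← Complex.exp_nat_mul]
  rw [show -((n : ℂ) * (s : ℂ)) = n * -(s : ℂ) by ring]
  ring

theorem summable_one_div_succ_pow {p : ℕ} (hp : 1 < p) :
    Summable fun j : ℕ => 1 / ((j : ℝ) + 1) ^ p := by
  have := (summable_nat_add_iff 1).2 (Real.summable_one_div_nat_pow.2 hp)
  simpa using this

/-- The power moment `∑ k ^ (p + 1) * exp (-k * x)`. -/
noncomputable def geomMoment (p : ℕ) (x : ℝ) : ℝ :=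
  ∑' k : ℕ, (k + 1 : ℝ) ^ (p + 1) * Real.exp (-x) ^ (k + 1)

theorem hasSum_logMoment (p : ℕ) {s : ℝ} (hs : 0 < s) :
    HasSum (fun m : ℕ => (m + 1 : ℝ) ^ p / (m + 1) * geomMoment p ((m + 1) * s))
      (logMoment p s) := by
  have h := (Equiv.prodComm ℕ ℕ).hasSum_iff.2 (summable_logMoment p hs).hasSum
  have h2 := HasSum.prod_fiberwise h fun m => (h.summable.prod_factor m).hasSum
  refine h2.congr_fun fun m => ?_
  rw [geomMoment, ← tsum_mul_left]
  refine tsum_congr fun k => ?_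
  simp only [Function.comp_apply, Equiv.prodComm_apply, Prod.swap, pairWeight, pairDegree]
  rw [show -((m + 1 : ℝ) * s) = (m + 1 : ℕ) * (-s) by push_cast; ring, Real.exp_nat_mul,
    ← pow_mul, mul_comm (m + 1) (k + 1)]
  push_cast
  rw [mul_pow, pow_succ]
  ring

theorem hasSum_choose_mul_exp (j : ℕ) {x : ℝ} (hx : 0 < x) :
    HasSum (fun k : ℕ => ((k + j).choose j : ℝ) * Real.exp (-x) ^ k)
      ((1 - Real.exp (-x))⁻¹ ^ (j + 1)) := by
  have h : ‖Real.exp (-x)‖ < 1 := by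
    rw [Real.norm_of_nonneg (Real.exp_pos _).le]
    exact Real.exp_lt_one_iff.2 (neg_lt_zero.2 hx)
  have h2 := (summable_choose_mul_geometric_of_norm_lt_one j h).hasSum
  rwa [tsum_choose_mul_geometric_of_norm_lt_one j h, one_div, ← inv_pow] at h2

theorem geomMoment_zero {x : ℝ} (hx : 0 < x) :
    geomMoment 0 x = Real.exp (-x) * (1 - Real.exp (-x))⁻¹ ^ 2 := by
  have h1 := hasSum_choose_mul_exp 1 hx
  rw [geomMoment, ← (h1.mul_left (Real.exp (-x))).tsum_eq]
  refine tsum_congr fun k => ?_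
  simp
  ring

theorem geomMoment_one {x : ℝ} (hx : 0 < x) : geomMoment 1 x = Real.exp (-x) *
    (2 * (1 - Real.exp (-x))⁻¹ ^ 3 - (1 - Real.exp (-x))⁻¹ ^ 2) := by
  have h1 := hasSum_choose_mul_exp 1 hx
  have h2 := hasSum_choose_mul_exp 2 hx
  rw [geomMoment, ← (((h2.mul_left 2).sub h1).mul_left (Real.exp (-x))).tsum_eq]
  refine tsum_congr fun k => ?_
  rw [Nat.cast_choose_eq_ascPochhammer_div, Nat.cast_choose_eq_ascPochhammer_div]
  simp [ascPochhammer_succ_right, Nat.factorial]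
  ring

theorem geomMoment_two {x : ℝ} (hx : 0 < x) : geomMoment 2 x = Real.exp (-x) *
    (6 * (1 - Real.exp (-x))⁻¹ ^ 4 - 6 * (1 - Real.exp (-x))⁻¹ ^ 3 +
      (1 - Real.exp (-x))⁻¹ ^ 2) := by
  have h1 := hasSum_choose_mul_exp 1 hx
  have h2 := hasSum_choose_mul_exp 2 hx
  have h3 := hasSum_choose_mul_exp 3 hx
  rw [geomMoment, ← ((((h3.mul_left 6).sub (h2.mul_left 6)).add h1).mul_left
    (Real.exp (-x))).tsum_eq]
  refine tsum_congr fun k => ?_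
  rw [Nat.cast_choose_eq_ascPochhammer_div, Nat.cast_choose_eq_ascPochhammer_div,
    Nat.cast_choose_eq_ascPochhammer_div]
  simp [ascPochhammer_succ_right, Nat.factorial]
  ring

theorem geomMoment_three {x : ℝ} (hx : 0 < x) : geomMoment 3 x = Real.exp (-x) *
    (24 * (1 - Real.exp (-x))⁻¹ ^ 5 - 36 * (1 - Real.exp (-x))⁻¹ ^ 4 +
      14 * (1 - Real.exp (-x))⁻¹ ^ 3 - (1 - Real.exp (-x))⁻¹ ^ 2) := by
  have h1 := hasSum_choose_mul_exp 1 hx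
  have h2 := hasSum_choose_mul_exp 2 hx
  have h3 := hasSum_choose_mul_exp 3 hx
  have h4 := hasSum_choose_mul_exp 4 hx
  rw [geomMoment, ← (((((h4.mul_left 24).sub (h3.mul_left 36)).add (h2.mul_left 14)).sub
    h1).mul_left (Real.exp (-x))).tsum_eq]
  refine tsum_congr fun k => ?_
  rw [Nat.cast_choose_eq_ascPochhammer_div, Nat.cast_choose_eq_ascPochhammer_div,
    Nat.cast_choose_eq_ascPochhammer_div, Nat.cast_choose_eq_ascPochhammer_div]
  simp [ascPochhammer_succ_right, Nat.factorial]
  ring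

theorem tendsto_tsum_dilate {q : ℕ} (hq : 1 < q) {h : ℝ → ℝ} {C L : ℝ}
    (hC : ∀ x, 0 < x → |h x| ≤ C) (hL : Tendsto h (nhdsWithin 0 (Set.Ioi 0)) (nhds L)) :
    Tendsto (fun s => ∑' m : ℕ, 1 / (m + 1 : ℝ) ^ q * h ((m + 1) * s))
      (nhdsWithin 0 (Set.Ioi 0)) (nhds ((∑' m : ℕ, 1 / (m + 1 : ℝ) ^ q) * L)) := by
  rw [← tsum_mul_right]
  refine tendsto_tsum_of_dominated_convergence ((summable_one_div_succ_pow hq).mul_right C)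
    (fun m => ?_) ?_
  · have ht : Tendsto (fun s : ℝ => (m + 1 : ℝ) * s) (nhdsWithin 0 (Set.Ioi 0))
        (nhdsWithin 0 (Set.Ioi 0)) := by
      refine tendsto_nhdsWithin_iff.2 ⟨?_, ?_⟩
      · exact ((show Continuous fun s : ℝ => (m + 1 : ℝ) * s by fun_prop).tendsto' 0 0
          (by simp)).mono_left nhdsWithin_le_nhds
      · filter_upwards [self_mem_nhdsWithin] with s hs
        exact mul_pos (show (0 : ℝ) < m + 1 by positivity) hs
    exact (hL.comp ht).const_mul _
  · filter_upwards [self_mem_nhdsWithin] with s hs m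
    rw [norm_mul, Real.norm_of_nonneg (by positivity)]
    exact mul_le_mul_of_nonneg_left (hC _ (mul_pos (by positivity) hs)) (by positivity)

theorem exp_neg_mul_one_add_pow_le (n : ℕ) {x : ℝ} (hx : 0 < x) :
    Real.exp (-x) * (1 + x) ^ n ≤ n.factorial * Real.exp 1 := by
  have h := Real.pow_div_factorial_le_exp (1 + x) (by linarith) n
  rw [div_le_iff₀ (by positivity), Real.exp_add] at h
  calc Real.exp (-x) * (1 + x) ^ n ≤ Real.exp (-x) * (Real.exp 1 * Real.exp x * n.factorial) := by
        gcongr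
    _ = n.factorial * Real.exp 1 := by
        rw [Real.exp_neg]
        field_simp

theorem div_one_sub_exp_neg_le {x : ℝ} (hx : 0 < x) : x * (1 - Real.exp (-x))⁻¹ ≤ 1 + x := by
  have h1 : 0 < 1 - Real.exp (-x) := by
    have := Real.exp_lt_one_iff.2 (neg_lt_zero.2 hx); linarith
  have h2 := Real.add_one_le_exp x
  rw [mul_inv_le_iff₀ h1]
  have h3 : Real.exp (-x) * (1 + x) ≤ 1 := by
    rw [Real.exp_neg, inv_mul_le_iff₀ (Real.exp_pos x)]
    linarith
  linarith

theorem abs_div_one_sub_exp_neg_sub_le {x : ℝ} (hx : 0 < x) (hx1 : x ≤ 1) :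
    |x * (1 - Real.exp (-x))⁻¹ - 1 - x / 2| ≤ 3 * x ^ 2 := by
  have hb := Real.exp_bound (x := -x) (by rwa [abs_neg, abs_of_pos hx]) (n := 3) (by norm_num)
  have h1 : 0 < 1 - Real.exp (-x) := by
    have := Real.exp_lt_one_iff.2 (neg_lt_zero.2 hx); linarith
  simp only [Finset.sum_range_succ, Finset.sum_range_zero, abs_neg, abs_of_pos hx] at hb
  norm_num [Nat.factorial] at hb
  rw [abs_le] at hb
  have e : x * (1 - Real.exp (-x))⁻¹ - 1 - x / 2 =
      (x - (1 + x / 2) * (1 - Real.exp (-x))) / (1 - Real.exp (-x)) := by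
    field_simp
    ring
  rw [e, abs_div, abs_of_pos h1, div_le_iff₀ h1]
  set δ := Real.exp (-x) - (1 + -x + x ^ 2 / 2) with hδ
  have er : Real.exp (-x) = 1 - x + x ^ 2 / 2 + δ := by rw [hδ]; ring
  rw [er] at h1 ⊢
  rw [abs_le]
  have hx3 : 0 < x ^ 3 := by positivity
  have hx4 : x ^ 4 ≤ x ^ 3 := pow_le_pow_of_le_one hx.le hx1 (by norm_num)
  have hx5 : x ^ 5 ≤ x ^ 3 := pow_le_pow_of_le_one hx.le hx1 (by norm_num)
  have hx5' : 0 < x ^ 5 := by positivity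
  have hxδ : |x * δ| ≤ x ^ 3 * (2 / 9) := by
    rw [abs_mul, abs_of_pos hx]
    have : |δ| ≤ x ^ 3 * (2 / 9) := abs_le.2 hb
    nlinarith [abs_nonneg δ]
  have hxδ2 : |x ^ 2 * δ| ≤ x ^ 3 * (2 / 9) := by
    rw [abs_mul, abs_of_pos (by positivity)]
    have : |δ| ≤ x ^ 3 * (2 / 9) := abs_le.2 hb
    nlinarith [abs_nonneg δ, pow_le_one₀ hx.le hx1 (n := 2)]
  rw [abs_le] at hxδ hxδ2
  constructor <;> nlinarith [hb.1, hb.2]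

theorem one_sub_exp_neg_pos {x : ℝ} (hx : 0 < x) : 0 < 1 - Real.exp (-x) := by
  have := Real.exp_lt_one_iff.2 (neg_lt_zero.2 hx)
  linarith

theorem tendsto_div_one_sub_exp_neg :
    Tendsto (fun x => x * (1 - Real.exp (-x))⁻¹) (nhdsWithin 0 (Set.Ioi 0)) (nhds 1) := by
  have h1 : Tendsto (fun x : ℝ => 1 + x / 2 + 3 * x ^ 2) (nhdsWithin 0 (Set.Ioi 0)) (nhds 1) :=
    ((show Continuous fun x : ℝ => 1 + x / 2 + 3 * x ^ 2 by fun_prop).tendsto' 0 1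
      (by simp)).mono_left nhdsWithin_le_nhds
  have h2 : Tendsto (fun x : ℝ => 1 + x / 2 - 3 * x ^ 2) (nhdsWithin 0 (Set.Ioi 0)) (nhds 1) :=
    ((show Continuous fun x : ℝ => 1 + x / 2 - 3 * x ^ 2 by fun_prop).tendsto' 0 1
      (by simp)).mono_left nhdsWithin_le_nhds
  have hev : ∀ᶠ x : ℝ in nhdsWithin 0 (Set.Ioi 0), 0 < x ∧ x ≤ 1 :=
    mem_of_superset (Ioc_mem_nhdsGT one_pos) fun x hx => hx
  refine tendsto_of_tendsto_of_tendsto_of_le_of_le' h2 h1 ?_ ?_ <;>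
  · filter_upwards [hev] with x hx
    have := abs_le.1 (abs_div_one_sub_exp_neg_sub_le hx.1 hx.2)
    linarith [this.1, this.2]

theorem tendsto_exp_neg_nhdsGT_zero :
    Tendsto (fun x => Real.exp (-x)) (nhdsWithin 0 (Set.Ioi 0)) (nhds 1) :=
  ((show Continuous fun x : ℝ => Real.exp (-x) by fun_prop).tendsto' 0 1
    (by simp)).mono_left nhdsWithin_le_nhds

theorem tendsto_id_nhdsGT_zero :
    Tendsto (fun x : ℝ => x) (nhdsWithin 0 (Set.Ioi 0)) (nhds 0) :=
  nhdsWithin_le_nhds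

/-- Scaled moments `s ^ (2 * p) * logMoment p s` as dilated sums. -/
theorem tendsto_pow_mul_logMoment {p q : ℕ} {C L : ℝ} (hq : 1 < q + 1)
    (hC : ∀ x, 0 < x → |x ^ (p + q) * geomMoment p x| ≤ C)
    (hL : Tendsto (fun x => x ^ (p + q) * geomMoment p x) (nhdsWithin 0 (Set.Ioi 0)) (nhds L)) :
    Tendsto (fun s => s ^ (p + q) * logMoment p s) (nhdsWithin 0 (Set.Ioi 0))
      (nhds ((∑' m : ℕ, 1 / (m + 1 : ℝ) ^ (q + 1)) * L)) := by
  refine (tendsto_tsum_dilate hq hC hL).congr' ?_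
  filter_upwards [self_mem_nhdsWithin] with s hs
  rw [← (hasSum_logMoment p hs).tsum_eq, ← tsum_mul_left]
  refine tsum_congr fun m => ?_
  rw [mul_pow]
  have : (m + 1 : ℝ) ≠ 0 := by positivity
  field_simp
  ring

theorem tendsto_logMoment_two : Tendsto (fun s => s ^ 4 * logMoment 2 s)
    (nhdsWithin 0 (Set.Ioi 0)) (nhds (6 * zeta3)) := by
  have e : ∀ x, 0 < x → x ^ 4 * geomMoment 2 x = Real.exp (-x) *
      (6 * (x * (1 - Real.exp (-x))⁻¹) ^ 4 - 6 * x * (x * (1 - Real.exp (-x))⁻¹) ^ 3 +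
        x ^ 2 * (x * (1 - Real.exp (-x))⁻¹) ^ 2) := fun x hx => by
    rw [geomMoment_two hx]
    ring
  rw [mul_comm, zeta3]
  refine tendsto_pow_mul_logMoment (p := 2) (q := 2) (C := 13 * ((4).factorial * Real.exp 1))
    (by norm_num) (fun x hx => ?_) ?_
  · rw [e x hx]
    have hy := div_one_sub_exp_neg_le hx
    have hy0 : 0 < x * (1 - Real.exp (-x))⁻¹ :=
      mul_pos hx (inv_pos.2 (one_sub_exp_neg_pos hx))
    set y := x * (1 - Real.exp (-x))⁻¹
    refine le_trans ?_ (mul_le_mul_of_nonneg_left (exp_neg_mul_one_add_pow_le 4 hx)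
      (by norm_num : (0 : ℝ) ≤ 13))
    rw [abs_mul, abs_of_pos (Real.exp_pos _), mul_left_comm]
    refine mul_le_mul_of_nonneg_left ?_ (Real.exp_pos _).le
    have a1 : y ^ 4 ≤ (1 + x) ^ 4 := by gcongr
    have a2 : x * y ^ 3 ≤ (1 + x) * (1 + x) ^ 3 := by gcongr; linarith
    have a3 : x ^ 2 * y ^ 2 ≤ (1 + x) ^ 2 * (1 + x) ^ 2 := by gcongr; linarith
    have b1 : 0 ≤ y ^ 4 := by positivity
    have b2 : 0 ≤ x * y ^ 3 := by positivity
    have b3 : 0 ≤ x ^ 2 * y ^ 2 := by positivity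
    rw [abs_le]
    constructor <;> linarith
  · have hy := tendsto_div_one_sub_exp_neg
    have hx := tendsto_id_nhdsGT_zero
    have := tendsto_exp_neg_nhdsGT_zero.mul ((((hy.pow 4).const_mul 6).sub
      ((hx.const_mul 6).mul (hy.pow 3))).add ((hx.pow 2).mul (hy.pow 2)))
    norm_num at this
    refine this.congr' ?_
    filter_upwards [self_mem_nhdsWithin] with x hx
    exact (e x hx).symm

theorem tendsto_logMoment_three : Tendsto (fun s => s ^ 6 * logMoment 3 s)
    (nhdsWithin 0 (Set.Ioi 0)) (nhds 0) := by
  have e : ∀ x, 0 < x → x ^ 6 * geomMoment 3 x = Real.exp (-x) *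
      (24 * x * (x * (1 - Real.exp (-x))⁻¹) ^ 5 - 36 * x ^ 2 * (x * (1 - Real.exp (-x))⁻¹) ^ 4 +
        14 * x ^ 3 * (x * (1 - Real.exp (-x))⁻¹) ^ 3 -
        x ^ 4 * (x * (1 - Real.exp (-x))⁻¹) ^ 2) := fun x hx => by
    rw [geomMoment_three hx]
    ring
  suffices h : Tendsto (fun s => s ^ (3 + 3) * logMoment 3 s) (nhdsWithin 0 (Set.Ioi 0))
      (nhds ((∑' m : ℕ, 1 / (m + 1 : ℝ) ^ (3 + 1)) * 0)) by rwa [mul_zero] at h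
  refine tendsto_pow_mul_logMoment (p := 3) (q := 3) (C := 75 * ((6).factorial * Real.exp 1))
    (by norm_num) (fun x hx => ?_) ?_
  · rw [e x hx]
    have hy := div_one_sub_exp_neg_le hx
    have hy0 : 0 < x * (1 - Real.exp (-x))⁻¹ :=
      mul_pos hx (inv_pos.2 (one_sub_exp_neg_pos hx))
    set y := x * (1 - Real.exp (-x))⁻¹
    refine le_trans ?_ (mul_le_mul_of_nonneg_left (exp_neg_mul_one_add_pow_le 6 hx)
      (by norm_num : (0 : ℝ) ≤ 75))
    rw [abs_mul, abs_of_pos (Real.exp_pos _), mul_left_comm]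
    refine mul_le_mul_of_nonneg_left ?_ (Real.exp_pos _).le
    have a1 : x * y ^ 5 ≤ (1 + x) * (1 + x) ^ 5 := by gcongr; linarith
    have a2 : x ^ 2 * y ^ 4 ≤ (1 + x) ^ 2 * (1 + x) ^ 4 := by gcongr; linarith
    have a3 : x ^ 3 * y ^ 3 ≤ (1 + x) ^ 3 * (1 + x) ^ 3 := by gcongr; linarith
    have a4 : x ^ 4 * y ^ 2 ≤ (1 + x) ^ 4 * (1 + x) ^ 2 := by gcongr; linarith
    have b1 : 0 ≤ x * y ^ 5 := by positivity
    have b2 : 0 ≤ x ^ 2 * y ^ 4 := by positivity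
    have b3 : 0 ≤ x ^ 3 * y ^ 3 := by positivity
    have b4 : 0 ≤ x ^ 4 * y ^ 2 := by positivity
    rw [abs_le]
    constructor <;> linarith
  · have hy := tendsto_div_one_sub_exp_neg
    have hx := tendsto_id_nhdsGT_zero
    have := tendsto_exp_neg_nhdsGT_zero.mul (((((hx.const_mul 24).mul (hy.pow 5)).sub
      (((hx.pow 2).const_mul 36).mul (hy.pow 4))).add
      (((hx.pow 3).const_mul 14).mul (hy.pow 3))).sub ((hx.pow 4).mul (hy.pow 2)))
    norm_num at this
    refine this.congr' ?_
    filter_upwards [self_mem_nhdsWithin] with x hx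
    exact (e x hx).symm

theorem sq_mul_geomMoment_one_sub {x : ℝ} (hx : 0 < x) :
    x ^ 2 * (geomMoment 1 x - 2 / x ^ 3) = (Real.exp (-x) *
      (2 * (x * (1 - Real.exp (-x))⁻¹) ^ 3 - x * (x * (1 - Real.exp (-x))⁻¹) ^ 2) - 2) / x := by
  rw [geomMoment_one hx]
  field_simp

theorem abs_sq_mul_geomMoment_one_sub_le {x : ℝ} (hx : 0 < x) (hx1 : x ≤ 1) :
    |x ^ 2 * (geomMoment 1 x - 2 / x ^ 3)| ≤ 127 * x := by
  rw [sq_mul_geomMoment_one_sub hx, abs_div, abs_of_pos hx, div_le_iff₀ hx]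
  have hb := abs_div_one_sub_exp_neg_sub_le hx hx1
  have h1 := one_sub_exp_neg_pos hx
  have hy0 : 0 < x * (1 - Real.exp (-x))⁻¹ := mul_pos hx (inv_pos.2 h1)
  have hr : Real.exp (-x) * (x * (1 - Real.exp (-x))⁻¹) = x * (1 - Real.exp (-x))⁻¹ - x := by
    field_simp
    ring
  set y := x * (1 - Real.exp (-x))⁻¹
  set e := y - 1 - x / 2 with he
  have ye : y = 1 + x / 2 + e := by rw [he]; ring
  have hid : Real.exp (-x) * (2 * y ^ 3 - x * y ^ 2) - 2 =
      -x ^ 2 / 2 + e * (6 - x ^ 2 / 2) + 6 * e ^ 2 + 2 * e ^ 3 := by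
    have : Real.exp (-x) * (2 * y ^ 3 - x * y ^ 2) = (y - x) * (2 * y ^ 2 - x * y) := by
      rw [← hr]; ring
    rw [this, ye]
    ring
  have hx2 : x ^ 2 ≤ 1 := pow_le_one₀ hx.le hx1
  have he3 : |e| ≤ 3 := hb.trans (by linarith)
  have q1 : |e * (6 - x ^ 2 / 2)| ≤ 3 * x ^ 2 * 6 := by
    rw [abs_mul]
    refine mul_le_mul hb ?_ (abs_nonneg _) (by positivity)
    rw [abs_le]; constructor <;> linarith [sq_nonneg x]
  have q2 : |e ^ 2| ≤ 3 * x ^ 2 * 3 := by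
    rw [sq, abs_mul]
    exact mul_le_mul hb he3 (abs_nonneg _) (by positivity)
  have q3 : |e ^ 3| ≤ 3 * x ^ 2 * 3 * 3 := by
    rw [pow_succ, abs_mul]
    exact mul_le_mul q2 he3 (abs_nonneg _) (by positivity)
  rw [hid]
  rw [abs_le] at q1 q2 q3 ⊢
  constructor <;> nlinarith [sq_nonneg x]

theorem tendsto_logMoment_one :
    Tendsto (fun s => s ^ 2 * (logMoment 1 s - 2 * zeta3 / s ^ 3))
      (nhdsWithin 0 (Set.Ioi 0)) (nhds 0) := by
  suffices h : Tendsto (fun s => s ^ 2 * (logMoment 1 s - 2 * zeta3 / s ^ 3))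
      (nhdsWithin 0 (Set.Ioi 0)) (nhds ((∑' m : ℕ, 1 / (m + 1 : ℝ) ^ 2) * 0)) by
    rwa [mul_zero] at h
  refine (tendsto_tsum_dilate (q := 2) (by norm_num)
    (h := fun x => x ^ 2 * (geomMoment 1 x - 2 / x ^ 3))
    (C := 127 + 3 * ((3).factorial * Real.exp 1) + 2) (fun x hx => ?_) ?_).congr' ?_
  · have hE : 0 ≤ ((3).factorial * Real.exp 1 : ℝ) := by positivity
    rcases le_total x 1 with h | h
    · refine (abs_sq_mul_geomMoment_one_sub_le hx h).trans ?_
      linarith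
    · rw [sq_mul_geomMoment_one_sub hx]
      have hy := div_one_sub_exp_neg_le hx
      have hy0 : 0 < x * (1 - Real.exp (-x))⁻¹ :=
        mul_pos hx (inv_pos.2 (one_sub_exp_neg_pos hx))
      set y := x * (1 - Real.exp (-x))⁻¹
      have k : |Real.exp (-x) * (2 * y ^ 3 - x * y ^ 2)| ≤ 3 * ((3).factorial * Real.exp 1) := by
        refine le_trans ?_ (mul_le_mul_of_nonneg_left (exp_neg_mul_one_add_pow_le 3 hx)
          (by norm_num : (0 : ℝ) ≤ 3))
        rw [abs_mul, abs_of_pos (Real.exp_pos _), mul_left_comm]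
        refine mul_le_mul_of_nonneg_left ?_ (Real.exp_pos _).le
        have a1 : y ^ 3 ≤ (1 + x) ^ 3 := by gcongr
        have a2 : x * y ^ 2 ≤ (1 + x) * (1 + x) ^ 2 := by gcongr; linarith
        have b1 : 0 ≤ y ^ 3 := by positivity
        have b2 : 0 ≤ x * y ^ 2 := by positivity
        rw [abs_le]
        constructor <;> linarith
      rw [abs_div, abs_of_pos hx]
      refine (div_le_self (abs_nonneg _) h).trans ?_
      refine (abs_sub _ _).trans ?_
      rw [abs_two]
      linarith
  · refine squeeze_zero_norm' (a := fun x => 127 * x) ?_ ?_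
    · filter_upwards [Ioc_mem_nhdsGT one_pos] with x hx
      exact abs_sq_mul_geomMoment_one_sub_le hx.1 hx.2
    · simpa using tendsto_id_nhdsGT_zero.const_mul 127
  · filter_upwards [self_mem_nhdsWithin] with s hs
    have hs : 0 < s := hs
    have hz := (summable_one_div_succ_pow (p := 3) (by norm_num)).hasSum
    have h := ((hasSum_logMoment 1 hs).sub (hz.mul_left (2 / s ^ 3))).mul_left (s ^ 2)
    rw [show 2 * zeta3 / s ^ 3 = 2 / s ^ 3 * ∑' j : ℕ, 1 / ((j : ℝ) + 1) ^ 3 by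
      rw [zeta3]; ring, ← h.tsum_eq]
    refine tsum_congr fun m => ?_
    have : (m + 1 : ℝ) ≠ 0 := by positivity
    field_simp

theorem hasSum_nat_mul_exp_neg_pow {x : ℝ} (hx : 0 < x) :
    HasSum (fun n : ℕ => (n : ℝ) * Real.exp (-x) ^ n) (geomMoment 0 x) := by
  have h := ((hasSum_choose_mul_exp 1 hx).mul_left (Real.exp (-x)))
  rw [← hasSum_nat_add_iff' 1, geomMoment_zero hx]
  simp only [Finset.range_one, Finset.sum_singleton, Nat.cast_zero, zero_mul, sub_zero]
  refine h.congr_fun fun n => ?_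
  simp
  ring

/-- The frequencies `2 * π * k`, `k ≥ 1`, in the partial fraction expansion. -/
noncomputable def freq (k : ℕ) : ℝ := 2 * π * (k + 1)

theorem one_le_freq (k : ℕ) : 1 ≤ freq k := by
  have : (0 : ℝ) ≤ k := k.cast_nonneg
  rw [freq]
  nlinarith [Real.pi_gt_three]

theorem hasSum_partialFractions {x : ℝ} (hx : 0 < x) :
    HasSum (fun k : ℕ => 2 * (x ^ 2 - freq k ^ 2) / (x ^ 2 + freq k ^ 2) ^ 2)
      (geomMoment 0 x - 1 / x ^ 2) := by
  have hz : 0 < (Complex.I * (x / (2 * π) : ℝ)).im := by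
    rw [Complex.I_mul_im, Complex.ofReal_re]
    positivity
  let z : UpperHalfPlane := ⟨Complex.I * (x / (2 * π) : ℝ), hz⟩
  have hzc : (z : ℂ) = Complex.I * (x / (2 * π) : ℝ) := rfl
  have hπ : (π : ℂ) ≠ 0 := by exact_mod_cast Real.pi_ne_zero
  have hS : Summable fun n : ℤ => 1 / ((z : ℂ) + n) ^ 2 := by
    have := EisensteinSeries.linear_right_summable (z : ℂ) 1 (k := 2) le_rfl
    refine this.congr fun n => ?_
    simp
  have hE := EisensteinSeries.qExpansion_identity (k := 1) le_rfl z
  have hq : Complex.exp (2 * π * Complex.I * z) = ((Real.exp (-x) : ℝ) : ℂ) := by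
    rw [hzc, Complex.ofReal_exp]
    congr 1
    push_cast
    field_simp
    rw [Complex.I_sq]
    ring
  have hG : ∑' n : ℕ, (n : ℂ) ^ 1 * Complex.exp (2 * π * Complex.I * z) ^ n =
      (geomMoment 0 x : ℝ) := by
    rw [hq, ← (hasSum_nat_mul_exp_neg_pow hx).tsum_eq, Complex.ofReal_tsum]
    refine tsum_congr fun n => ?_
    push_cast
    rw [pow_one]
  rw [hG] at hE
  have h1 := hS.hasSum.nat_add_neg
  rw [hE] at h1
  have h2 := (hasSum_nat_add_iff' 1).2 h1
  rw [← Complex.hasSum_ofReal]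
  have h3 := h2.mul_left (-1 / (4 * π ^ 2) : ℂ)
  have hxc : (x : ℂ) ≠ 0 := by exact_mod_cast hx.ne'
  have hI : Complex.I ^ 2 = -1 := Complex.I_sq
  have e : (-1 / (4 * π ^ 2) : ℂ) * ((-2 * π * Complex.I) ^ (1 + 1) / (Nat.factorial 1) *
      (geomMoment 0 x : ℝ) + 1 / ((z : ℂ) + (0 : ℤ)) ^ (1 + 1) - ∑ i ∈ Finset.range 1,
        (1 / ((z : ℂ) + (i : ℤ)) ^ (1 + 1) + 1 / ((z : ℂ) + ((-(i : ℤ) : ℤ) : ℂ)) ^ (1 + 1))) =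
      ((geomMoment 0 x - 1 / x ^ 2 : ℝ) : ℂ) := by
    simp only [Finset.range_one, Finset.sum_singleton, hzc]
    push_cast
    simp only [Nat.factorial, neg_zero, add_zero, mul_pow, hI]
    norm_num
    field_simp
    ring
  rw [← e]
  refine h3.congr_fun fun k => ?_
  have hfk : (freq k : ℂ) = 2 * π * (k + 1) := by rw [freq]; push_cast; ring
  have hne : (x ^ 2 + freq k ^ 2 : ℂ) ≠ 0 := by
    have : x ^ 2 + freq k ^ 2 ≠ 0 := by positivity
    exact_mod_cast this
  have hfac : (z + (k + 1) : ℂ) * (z - (k + 1)) = -(x ^ 2 + freq k ^ 2) / (4 * π ^ 2) := by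
    rw [hzc, hfk]
    push_cast
    field_simp
    linear_combination (4 * x ^ 2) * hI
  have hp : (z + (k + 1) : ℂ) ≠ 0 := fun h => by
    rw [h, zero_mul] at hfac
    exact div_ne_zero (neg_ne_zero.2 hne) (by simp [hπ]) hfac.symm
  have hm : (z - (k + 1) : ℂ) ≠ 0 := fun h => by
    rw [h, mul_zero] at hfac
    exact div_ne_zero (neg_ne_zero.2 hne) (by simp [hπ]) hfac.symm
  have hsum : 1 / ((z : ℂ) + (k + 1)) ^ 2 + 1 / ((z : ℂ) - (k + 1)) ^ 2 =
      2 * (z ^ 2 + (k + 1) ^ 2) / ((z + (k + 1) : ℂ) * (z - (k + 1))) ^ 2 := by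
    field_simp
    ring
  have hz2 : (z : ℂ) ^ 2 = - x ^ 2 / (4 * π ^ 2) := by
    rw [hzc]
    push_cast
    rw [mul_pow, hI]
    field_simp
    ring
  have hk2 : ((k : ℂ) + 1) ^ 2 = freq k ^ 2 / (4 * π ^ 2) := by
    rw [hfk]
    field_simp
    ring
  push_cast
  rw [← sub_eq_add_neg]
  rw [hsum, hfac, hz2, hk2]
  field_simp
  ring

/-- The contribution of the poles `±a * I` to the remainder `zetaRemainder`. -/
noncomputable def poleTerm (a x : ℝ) : ℝ :=
  (Real.exp (-x) / a ^ 2 + (x ^ 2 - a ^ 2) / (x ^ 2 + a ^ 2) ^ 2) / x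

/-- The remainder of the second order geometric moment after removing its singular part. -/
noncomputable def zetaRemainder (x : ℝ) : ℝ :=
  (geomMoment 0 x - 1 / x ^ 2 + Real.exp (-x) / 12) / x

theorem hasSum_one_div_freq_sq : HasSum (fun k => 2 / freq k ^ 2) (1 / 12) := by
  have h := (hasSum_nat_add_iff' 1).2 hasSum_zeta_two
  have h2 := h.mul_left (1 / (2 * π ^ 2))
  simp only [Finset.range_one, Finset.sum_singleton, Nat.cast_zero] at h2
  rw [show (1 / 12 : ℝ) = 1 / (2 * π ^ 2) * (π ^ 2 / 6 - 1 / 0 ^ 2) by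
    norm_num
    field_simp
    norm_num]
  refine h2.congr_fun fun k => ?_
  have : (k + 1 : ℝ) ≠ 0 := by positivity
  rw [freq]
  push_cast
  field_simp

theorem hasSum_poleTerm {x : ℝ} (hx : 0 < x) :
    HasSum (fun k => 2 * poleTerm (freq k) x) (zetaRemainder x) := by
  have h := ((hasSum_partialFractions hx).add
    (hasSum_one_div_freq_sq.mul_left (Real.exp (-x)))).div_const x
  rw [zetaRemainder, show Real.exp (-x) / 12 = Real.exp (-x) * (1 / 12) by ring]
  refine h.congr_fun fun k => ?_
  rw [poleTerm]
  ring

theorem rpow_neg_three_half {y : ℝ} (hy : 0 < y) : y ^ (-(3 / 2) : ℝ) = (y * √y)⁻¹ := by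
  rw [Real.rpow_neg hy.le, show (3 / 2 : ℝ) = 1 + 1 / 2 by norm_num, Real.rpow_add hy,
    Real.rpow_one, Real.sqrt_eq_rpow]

theorem mul_sqrt_mul_sqrt_le {a x : ℝ} (ha : 0 < a) (hx : 0 < x) :
    a * √a * √x ≤ x ^ 2 + a ^ 2 := by
  rcases le_total a x with h | h
  · calc a * √a * √x ≤ x * √x * √x := by gcongr
      _ = x ^ 2 := by rw [mul_assoc, Real.mul_self_sqrt hx.le, sq]
      _ ≤ _ := by nlinarith
  · calc a * √a * √x ≤ a * √a * √a := by gcongr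
      _ = a ^ 2 := by rw [mul_assoc, Real.mul_self_sqrt ha.le, sq]
      _ ≤ _ := by nlinarith

theorem abs_poleTerm_le {a x : ℝ} (ha : 1 ≤ a) (hx : 0 < x) :
    |poleTerm a x| ≤ 12 * a ^ (-(3 / 2) : ℝ) * (x + 1) ^ (-(3 / 2) : ℝ) := by
  have ha0 : 0 < a := by linarith
  rw [rpow_neg_three_half ha0, rpow_neg_three_half (by linarith : 0 < x + 1)]
  have hsa : √a ≤ a := by
    rw [Real.sqrt_le_left ha0.le]; nlinarith
  have hsa0 : 0 < √a := Real.sqrt_pos.2 ha0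
  have hsx0 : 0 < √x := Real.sqrt_pos.2 hx
  have hD : 0 < x ^ 2 + a ^ 2 := by positivity
  have haa : a * √a ≤ a ^ 2 := by nlinarith
  have hs2 : √2 ≤ 3 / 2 := by
    rw [Real.sqrt_le_left (by norm_num)]; norm_num
  rw [poleTerm, abs_div, abs_of_pos hx, div_le_iff₀ hx]
  rcases le_total x 1 with h | h
  · have k1 : (x + 1) * √(x + 1) ≤ 3 := by
      calc (x + 1) * √(x + 1) ≤ 2 * √2 := by gcongr <;> linarith
        _ ≤ 3 := by linarith
    have k2 : 1 / 3 ≤ ((x + 1) * √(x + 1))⁻¹ := by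
      rw [one_div]
      exact inv_anti₀ (by positivity) k1
    have k3 : 1 / a ^ 2 ≤ (a * √a)⁻¹ := by
      rw [one_div]
      exact inv_anti₀ (by positivity) haa
    have e : Real.exp (-x) / a ^ 2 + (x ^ 2 - a ^ 2) / (x ^ 2 + a ^ 2) ^ 2 =
        (Real.exp (-x) - 1) / a ^ 2 +
          x ^ 2 * (3 * a ^ 2 + x ^ 2) / (a ^ 2 * (x ^ 2 + a ^ 2) ^ 2) := by
      field_simp
      ring
    have m1 : |(Real.exp (-x) - 1) / a ^ 2| ≤ x * (1 / a ^ 2) := by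
      rw [abs_div, abs_of_pos (by positivity : 0 < a ^ 2), div_eq_mul_one_div]
      refine mul_le_mul_of_nonneg_right ?_ (by positivity)
      have := Real.add_one_le_exp (-x)
      have := Real.exp_le_one_iff.2 (neg_nonpos.2 hx.le)
      rw [abs_le]
      constructor <;> linarith
    have m2 : |x ^ 2 * (3 * a ^ 2 + x ^ 2) / (a ^ 2 * (x ^ 2 + a ^ 2) ^ 2)| ≤
        3 * x * (1 / a ^ 2) := by
      rw [abs_of_nonneg (by positivity), mul_one_div, div_le_div_iff₀ (by positivity)
        (by positivity)]
      have : x ^ 2 * (3 * a ^ 2 + x ^ 2) ≤ 3 * x * (x ^ 2 + a ^ 2) ^ 2 := by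
        have h1 : x * (3 * a ^ 2 + x ^ 2) ≤ 1 * (3 * (x ^ 2 + a ^ 2)) := by
          gcongr; nlinarith
        have h2 : x ^ 2 + a ^ 2 ≤ (x ^ 2 + a ^ 2) ^ 2 :=
          le_self_pow₀ (by nlinarith [sq_nonneg x]) two_ne_zero
        nlinarith
      calc _ = a ^ 2 * (x ^ 2 * (3 * a ^ 2 + x ^ 2)) := by ring
        _ ≤ a ^ 2 * (3 * x * (x ^ 2 + a ^ 2) ^ 2) := by gcongr
        _ = _ := by ring
    rw [e]
    refine (abs_add_le _ _).trans ?_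
    calc _ ≤ 12 * x * (1 / a ^ 2 * (1 / 3)) := by linarith
      _ ≤ 12 * x * ((a * √a)⁻¹ * ((x + 1) * √(x + 1))⁻¹) := by gcongr
      _ = _ := by ring
  · have k1 : (x + 1) * √(x + 1) ≤ 3 * (x * √x) := by
      calc (x + 1) * √(x + 1) ≤ (2 * x) * √(2 * x) := by gcongr <;> linarith
        _ = 2 * √2 * (x * √x) := by rw [Real.sqrt_mul (by norm_num)]; ring
        _ ≤ 3 * (x * √x) := by gcongr; linarith
    have k2 : 1 / 3 * (x * √x)⁻¹ ≤ ((x + 1) * √(x + 1))⁻¹ := by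
      rw [show 1 / 3 * (x * √x)⁻¹ = (3 * (x * √x))⁻¹ by ring]
      exact inv_anti₀ (by positivity) k1
    have hsx : √x ≤ x := by
      rw [Real.sqrt_le_left hx.le]; nlinarith
    have m1 : |Real.exp (-x) / a ^ 2| ≤ (a * √a)⁻¹ * (√x)⁻¹ := by
      rw [abs_of_pos (by positivity), div_eq_mul_inv, mul_comm]
      refine mul_le_mul (inv_anti₀ (by positivity) haa) ?_ (Real.exp_pos _).le (by positivity)
      rw [Real.exp_neg]
      refine inv_anti₀ (by positivity) ?_
      have := Real.add_one_le_exp x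
      linarith
    have m2 : |(x ^ 2 - a ^ 2) / (x ^ 2 + a ^ 2) ^ 2| ≤ (a * √a)⁻¹ * (√x)⁻¹ := by
      rw [abs_div, abs_of_pos (by positivity : 0 < (x ^ 2 + a ^ 2) ^ 2), ← mul_inv]
      calc |x ^ 2 - a ^ 2| / (x ^ 2 + a ^ 2) ^ 2 ≤ (x ^ 2 + a ^ 2) / (x ^ 2 + a ^ 2) ^ 2 := by
            gcongr
            rw [abs_le]
            constructor <;> nlinarith
        _ = (x ^ 2 + a ^ 2)⁻¹ := by field_simp
        _ ≤ _ := inv_anti₀ (by positivity) (mul_sqrt_mul_sqrt_le ha0 hx)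
    refine (abs_add_le _ _).trans ?_
    calc _ ≤ 4 * ((a * √a)⁻¹ * (√x)⁻¹) := by
            have : 0 < (a * √a)⁻¹ * (√x)⁻¹ := by positivity
            linarith
      _ = 12 * (a * √a)⁻¹ * (1 / 3 * (x * √x)⁻¹) * x := by field_simp; norm_num
      _ ≤ _ := by gcongr

theorem summable_freq_rpow : Summable fun k => freq k ^ (-(3 / 2) : ℝ) := by
  have h := (summable_nat_add_iff 1).2
    (Real.summable_nat_rpow.2 (by norm_num : (-(3 / 2) : ℝ) < -1))
  refine (h.mul_left ((2 * π) ^ (-(3 / 2) : ℝ))).congr fun k => ?_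
  rw [freq, Real.mul_rpow (x := 2 * π) (by positivity) (by positivity), Nat.cast_succ]

theorem exists_abs_zetaRemainder_le :
    ∃ C, 0 ≤ C ∧ ∀ x, 0 < x → |zetaRemainder x| ≤ C * (x + 1) ^ (-(3 / 2) : ℝ) := by
  refine ⟨∑' k, 24 * freq k ^ (-(3 / 2) : ℝ), tsum_nonneg fun k => ?_, fun x hx => ?_⟩
  · have := one_le_freq k
    positivity
  · rw [← tsum_mul_right, ← (hasSum_poleTerm hx).tsum_eq, ← Real.norm_eq_abs]
    refine tsum_of_norm_bounded
      (((summable_freq_rpow.mul_left 24).mul_right _).hasSum) fun k => ?_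
    rw [norm_mul, Real.norm_eq_abs, Real.norm_eq_abs, abs_two]
    have := abs_poleTerm_le (one_le_freq k) hx
    linarith

theorem integrableOn_add_one_rpow :
    MeasureTheory.IntegrableOn (fun x : ℝ => (x + 1) ^ (-(3 / 2) : ℝ)) (Set.Ioi 0) :=
  integrableOn_add_rpow_Ioi_of_lt (by norm_num) (by norm_num)

theorem continuousOn_zetaRemainder : ContinuousOn zetaRemainder (Set.Ioi 0) := by
  have h : ContinuousOn (fun x => (Real.exp (-x) * (1 - Real.exp (-x))⁻¹ ^ 2 - 1 / x ^ 2 +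
      Real.exp (-x) / 12) / x) (Set.Ioi 0) := by
    have h0 : ∀ x ∈ Set.Ioi (0 : ℝ), 1 - Real.exp (-x) ≠ 0 := fun x hx =>
      (one_sub_exp_neg_pos hx).ne'
    have h1 : ∀ x ∈ Set.Ioi (0 : ℝ), x ≠ 0 := fun x hx => (ne_of_gt hx)
    have h2 : ∀ x ∈ Set.Ioi (0 : ℝ), x ^ 2 ≠ 0 := fun x hx => pow_ne_zero _ (ne_of_gt hx)
    fun_prop (disch := assumption)
  refine h.congr fun x hx => ?_
  rw [zetaRemainder, geomMoment_zero hx]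

theorem continuousOn_poleTerm {a : ℝ} (ha : 0 < a) : ContinuousOn (poleTerm a) (Set.Ioi 0) := by
  have h1 : ∀ x ∈ Set.Ioi (0 : ℝ), x ≠ 0 := fun x hx => (ne_of_gt hx)
  have h2 : ∀ x ∈ Set.Ioi (0 : ℝ), (x ^ 2 + a ^ 2) ^ 2 ≠ 0 := fun x _ => by positivity
  have h3 : a ^ 2 ≠ 0 := by positivity
  unfold poleTerm
  fun_prop (disch := assumption)

theorem integrableOn_poleTerm {a : ℝ} (ha : 1 ≤ a) :
    MeasureTheory.IntegrableOn (poleTerm a) (Set.Ioi 0) := by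
  refine MeasureTheory.Integrable.mono'
    (integrableOn_add_one_rpow.const_mul (12 * a ^ (-(3 / 2) : ℝ)))
    ((continuousOn_poleTerm (by linarith)).aestronglyMeasurable measurableSet_Ioi) ?_
  filter_upwards [MeasureTheory.ae_restrict_mem measurableSet_Ioi] with x hx
  exact abs_poleTerm_le ha hx

theorem hasSum_integral_poleTerm :
    HasSum (fun k => 2 * ∫ x in Set.Ioi (0 : ℝ), poleTerm (freq k) x)
      (∫ x in Set.Ioi (0 : ℝ), zetaRemainder x) := by
  have h := MeasureTheory.hasSum_integral_of_summable_integral_norm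
    (μ := MeasureTheory.volume.restrict (Set.Ioi 0))
    (F := fun k x => 2 * poleTerm (freq k) x)
    (fun k => (integrableOn_poleTerm (one_le_freq k)).const_mul 2) ?_
  · have e : ∫ x in Set.Ioi (0 : ℝ), zetaRemainder x =
        ∫ x in Set.Ioi (0 : ℝ), ∑' k, 2 * poleTerm (freq k) x :=
      MeasureTheory.setIntegral_congr_fun measurableSet_Ioi fun x hx =>
        (hasSum_poleTerm hx).tsum_eq.symm
    rw [e]
    refine h.congr_fun fun k => ?_
    rw [MeasureTheory.integral_const_mul]
  · refine Summable.of_nonneg_of_le (fun k => MeasureTheory.integral_nonneg fun x => norm_nonneg _)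
      (fun k => ?_) (summable_freq_rpow.mul_right
        (24 * ∫ x in Set.Ioi (0 : ℝ), (x + 1) ^ (-(3 / 2) : ℝ)))
    rw [← mul_assoc, ← MeasureTheory.integral_const_mul]
    refine MeasureTheory.setIntegral_mono_on
      ((integrableOn_poleTerm (one_le_freq k)).const_mul 2).norm
      (integrableOn_add_one_rpow.const_mul _) measurableSet_Ioi fun x hx => ?_
    rw [norm_mul, Real.norm_eq_abs, Real.norm_eq_abs, abs_two]
    have := abs_poleTerm_le (one_le_freq k) hx
    linarith

theorem iUnion_Ioc_nat_mul {s : ℝ} (hs : 0 < s) :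
    ⋃ n : ℕ, Set.Ioc (n * s) ((n + 1) * s) = Set.Ioi 0 := by
  ext x
  simp only [Set.mem_iUnion, Set.mem_Ioc, Set.mem_Ioi]
  constructor
  · rintro ⟨n, hn, -⟩
    exact lt_of_le_of_lt (by positivity) hn
  · intro hx
    have hc : 0 < ⌈x / s⌉₊ := Nat.ceil_pos.2 (div_pos hx hs)
    obtain ⟨n, hn⟩ := Nat.exists_eq_succ_of_ne_zero hc.ne'
    refine ⟨n, ?_, ?_⟩
    · rw [← lt_div_iff₀ hs]
      exact Nat.lt_ceil.1 (by omega)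
    · rw [← div_le_iff₀ hs]
      have := Nat.le_ceil (x / s)
      rw [hn] at this
      exact_mod_cast this

theorem ceil_div_eq_of_mem_Ioc {s x : ℝ} (hs : 0 < s) {n : ℕ}
    (hx : x ∈ Set.Ioc (n * s) ((n + 1) * s)) : ⌈x / s⌉₊ = n + 1 := by
  rw [Nat.ceil_eq_iff (by omega), div_le_iff₀ hs, Nat.add_sub_cancel, lt_div_iff₀ hs]
  exact ⟨hx.1, by exact_mod_cast hx.2⟩

theorem hasSum_step_integral {f : ℝ → ℝ} {s : ℝ} (hs : 0 < s)
    (hf : MeasureTheory.IntegrableOn (fun x => f (⌈x / s⌉₊ * s)) (Set.Ioi 0)) :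
    HasSum (fun n : ℕ => s * f ((n + 1) * s)) (∫ x in Set.Ioi (0 : ℝ), f (⌈x / s⌉₊ * s)) := by
  rw [← iUnion_Ioc_nat_mul hs] at hf ⊢
  have hd : Pairwise (Function.onFun Disjoint
      fun n : ℕ => Set.Ioc (n * s) ((n + 1) * s)) := by
    intro m n hmn
    refine Set.disjoint_left.2 fun x hm hn => hmn ?_
    have h1 := ceil_div_eq_of_mem_Ioc hs hm
    rw [ceil_div_eq_of_mem_Ioc hs hn] at h1
    omega
  refine (MeasureTheory.hasSum_integral_iUnion (fun n => measurableSet_Ioc) hd hf).congr_fun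
    fun n => ?_
  rw [MeasureTheory.setIntegral_congr_fun (g := fun _ => f ((n + 1) * s)) measurableSet_Ioc
    fun x hx => by
      show f (⌈x / s⌉₊ * s) = _
      rw [ceil_div_eq_of_mem_Ioc hs hx, Nat.cast_succ]]
  rw [MeasureTheory.setIntegral_const, smul_eq_mul, MeasureTheory.measureReal_def,
    Real.volume_Ioc, ENNReal.toReal_ofReal (by nlinarith)]
  ring

theorem le_ceil_div_mul {s : ℝ} (hs : 0 < s) (x : ℝ) : x ≤ ⌈x / s⌉₊ * s :=
  (div_le_iff₀ hs).1 (Nat.le_ceil _)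

theorem measurable_comp_ceil_div_mul (f : ℝ → ℝ) (s : ℝ) :
    Measurable fun x : ℝ => f (⌈x / s⌉₊ * s) :=
  (measurable_from_nat (f := fun n : ℕ => f (n * s))).comp
    (Nat.measurable_ceil.comp (measurable_id.div_const s))

/-- Riemann sums of a function dominated by an antitone integrable function. -/
theorem tendsto_riemannSum {f g : ℝ → ℝ} (hf : ContinuousOn f (Set.Ioi 0))
    (hg : AntitoneOn g (Set.Ioi 0)) (hgi : MeasureTheory.IntegrableOn g (Set.Ioi 0))
    (hfg : ∀ x, 0 < x → |f x| ≤ g x) :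
    Tendsto (fun s => s * ∑' n : ℕ, f ((n + 1) * s)) (nhdsWithin 0 (Set.Ioi 0))
      (nhds (∫ x in Set.Ioi (0 : ℝ), f x)) := by
  have hb : ∀ s, 0 < s → ∀ x, 0 < x → ‖f (⌈x / s⌉₊ * s)‖ ≤ g x := fun s hs x hx => by
    have h := le_ceil_div_mul hs x
    exact (hfg _ (hx.trans_le h)).trans (hg hx (hx.trans_le h) h)
  have hlim : Tendsto (fun s => ∫ x in Set.Ioi (0 : ℝ), f (⌈x / s⌉₊ * s))
      (nhdsWithin 0 (Set.Ioi 0)) (nhds (∫ x in Set.Ioi (0 : ℝ), f x)) := by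
    refine MeasureTheory.tendsto_integral_filter_of_dominated_convergence g
      (Eventually.of_forall fun s => (measurable_comp_ceil_div_mul f s).aestronglyMeasurable)
      ?_ hgi ?_
    · filter_upwards [self_mem_nhdsWithin] with s hs
      filter_upwards [MeasureTheory.ae_restrict_mem measurableSet_Ioi] with x hx
      exact hb s hs x hx
    · filter_upwards [MeasureTheory.ae_restrict_mem measurableSet_Ioi] with x hx
      have hx : 0 < x := hx
      refine (hf.continuousAt (Ioi_mem_nhds hx)).tendsto.comp ?_
      have hid : Tendsto (fun s : ℝ => x + s) (nhdsWithin 0 (Set.Ioi 0)) (nhds x) :=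
        ((show Continuous fun s : ℝ => x + s by fun_prop).tendsto' 0 x
          (by simp)).mono_left nhdsWithin_le_nhds
      refine tendsto_of_tendsto_of_tendsto_of_le_of_le' tendsto_const_nhds hid ?_ ?_
      · filter_upwards [self_mem_nhdsWithin] with s hs
        exact le_ceil_div_mul hs x
      · filter_upwards [self_mem_nhdsWithin] with s hs
        have hs : 0 < s := hs
        have h1 := Nat.ceil_lt_add_one (div_pos hx hs).le
        calc (⌈x / s⌉₊ : ℝ) * s ≤ (x / s + 1) * s := by gcongr
          _ = x + s := by field_simp
  refine hlim.congr' ?_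
  filter_upwards [self_mem_nhdsWithin] with s hs
  rw [← tsum_mul_left, (hasSum_step_integral hs ?_).tsum_eq]
  refine MeasureTheory.Integrable.mono' hgi
    (measurable_comp_ceil_div_mul f s).aestronglyMeasurable ?_
  filter_upwards [MeasureTheory.ae_restrict_mem measurableSet_Ioi] with x hx
  exact hb s hs x hx

theorem antitoneOn_add_one_rpow {C : ℝ} (hC : 0 ≤ C) :
    AntitoneOn (fun x : ℝ => C * (x + 1) ^ (-(3 / 2) : ℝ)) (Set.Ioi 0) := by
  intro x hx y _ hxy
  have hx : 0 < x := hx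
  refine mul_le_mul_of_nonneg_left ?_ hC
  exact Real.rpow_le_rpow_of_nonpos (by linarith) (by linarith) (by norm_num)

theorem logMoment_zero_sub_eq {s : ℝ} (hs : 0 < s) :
    logMoment 0 s - zeta3 / s ^ 2 - Real.log s / 12 =
      s * ∑' n : ℕ, zetaRemainder ((n + 1) * s) +
        Real.log ((1 - Real.exp (-s)) / s) / 12 := by
  have h1 := one_sub_exp_neg_pos hs
  have hlog := Real.hasSum_pow_div_log_of_abs_lt_one (x := Real.exp (-s)) (by
    rw [abs_of_pos (Real.exp_pos _)]; linarith)
  have hz := (summable_one_div_succ_pow (p := 3) (by norm_num)).hasSum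
  have h := ((hasSum_logMoment 0 hs).sub (hz.mul_left (1 / s ^ 2))).add (hlog.mul_left (1 / 12))
  rw [Real.log_div h1.ne' hs.ne', ← tsum_mul_left]
  have e : ∑' n : ℕ, s * zetaRemainder ((n + 1) * s) = logMoment 0 s -
      1 / s ^ 2 * zeta3 + 1 / 12 * -Real.log (1 - Real.exp (-s)) := by
    rw [zeta3, ← h.tsum_eq]
    refine tsum_congr fun n => ?_
    have : (n + 1 : ℝ) ≠ 0 := by positivity
    rw [zetaRemainder, show -((n + 1 : ℝ) * s) = (n + 1 : ℕ) * (-s) by push_cast; ring,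
      Real.exp_nat_mul]
    field_simp
  rw [e]
  ring

theorem tendsto_logMoment_zero_integral :
    Tendsto (fun s => logMoment 0 s - zeta3 / s ^ 2 - Real.log s / 12)
      (nhdsWithin 0 (Set.Ioi 0)) (nhds (∫ x in Set.Ioi (0 : ℝ), zetaRemainder x)) := by
  obtain ⟨C, hC, hb⟩ := exists_abs_zetaRemainder_le
  have h1 := tendsto_riemannSum continuousOn_zetaRemainder (antitoneOn_add_one_rpow hC)
    (integrableOn_add_one_rpow.const_mul C) hb
  have h2 : Tendsto (fun s => Real.log ((1 - Real.exp (-s)) / s) / 12)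
      (nhdsWithin 0 (Set.Ioi 0)) (nhds 0) := by
    have h3 : Tendsto (fun s => (1 - Real.exp (-s)) / s) (nhdsWithin 0 (Set.Ioi 0)) (nhds 1) := by
      have := tendsto_div_one_sub_exp_neg.inv₀ one_ne_zero
      rw [inv_one] at this
      refine this.congr fun s => ?_
      rw [mul_inv, inv_inv, div_eq_inv_mul]
    have := ((Real.continuousAt_log one_ne_zero).tendsto.comp h3).div_const 12
    rw [Real.log_one, zero_div] at this
    exact this
  have h := h1.add h2
  rw [add_zero] at h
  refine h.congr' ?_
  filter_upwards [self_mem_nhdsWithin] with s hs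
  exact (logMoment_zero_sub_eq hs).symm

theorem abs_mul_log_le {y : ℝ} (hy : 0 < y) :
    |y * Real.log y| ≤ 2 * y ^ (3 / 2 - 1 : ℝ) + y ^ (3 - 1 : ℝ) := by
  rw [show (3 / 2 - 1 : ℝ) = 1 / 2 by norm_num, show (3 - 1 : ℝ) = (2 : ℕ) by norm_num,
    Real.rpow_natCast]
  have hp : 0 < y ^ (1 / 2 : ℝ) := Real.rpow_pos_of_pos hy _
  rcases le_total y 1 with h | h
  · have h1 := (Real.abs_log_mul_self_rpow_lt y (1 / 2) hy h (by norm_num)).le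
    have e : y * Real.log y = y ^ (1 / 2 : ℝ) * (Real.log y * y ^ (1 / 2 : ℝ)) := by
      have : y ^ (1 / 2 : ℝ) * y ^ (1 / 2 : ℝ) = y := by
        rw [← Real.rpow_add hy]; norm_num
      linear_combination (-Real.log y) * this
    rw [e, abs_mul, abs_of_pos hp]
    nlinarith [sq_nonneg y]
  · have h1 := Real.log_le_self hy.le
    have h2 := Real.log_nonneg h
    rw [abs_of_nonneg (by positivity)]
    nlinarith

theorem integrableOn_rpow_mul_exp_neg_mul {b p : ℝ} (hp : 0 < p) (hb : 0 < b) :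
    MeasureTheory.IntegrableOn (fun y : ℝ => y ^ (p - 1) * Real.exp (-(b * y))) (Set.Ioi 0) := by
  refine (integrableOn_rpow_mul_exp_neg_mul_rpow (p := 1) (s := p - 1) (by linarith) one_pos
    hb).congr_fun (fun y _ => ?_) measurableSet_Ioi
  simp only [Real.rpow_one, neg_mul]

theorem integrableOn_logBound {b : ℝ} (hb : 0 < b) :
    MeasureTheory.IntegrableOn (fun y : ℝ => 2 * (y ^ (3 / 2 - 1 : ℝ) * Real.exp (-(b * y))) +
      y ^ (3 - 1 : ℝ) * Real.exp (-(b * y))) (Set.Ioi 0) :=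
  ((integrableOn_rpow_mul_exp_neg_mul (p := 3 / 2) (by norm_num) hb).const_mul 2).add
    (integrableOn_rpow_mul_exp_neg_mul (p := 3) (by norm_num) hb)

theorem norm_mul_log_mul_exp_le (b : ℝ) {y : ℝ} (hy : 0 < y) :
    ‖y * Real.log y * Real.exp (-(b * y))‖ ≤ 2 * (y ^ (3 / 2 - 1 : ℝ) * Real.exp (-(b * y))) +
      y ^ (3 - 1 : ℝ) * Real.exp (-(b * y)) := by
  rw [norm_mul, Real.norm_eq_abs, Real.norm_of_nonneg (Real.exp_pos _).le, ← mul_assoc, ← add_mul]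
  exact mul_le_mul_of_nonneg_right (abs_mul_log_le hy) (Real.exp_pos _).le

theorem integrableOn_mul_log_mul_exp {b : ℝ} (hb : 0 < b) :
    MeasureTheory.IntegrableOn (fun y : ℝ => y * Real.log y * Real.exp (-(b * y)))
      (Set.Ioi 0) := by
  refine MeasureTheory.Integrable.mono' (integrableOn_logBound hb)
    (Continuous.aestronglyMeasurable ?_) ?_
  · exact Real.continuous_mul_log.mul (by fun_prop)
  · filter_upwards [MeasureTheory.ae_restrict_mem measurableSet_Ioi] with y hy
    exact norm_mul_log_mul_exp_le b hy

theorem integral_norm_mul_log_mul_exp_le {b : ℝ} (hb : 1 ≤ b) :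
    ∫ y in Set.Ioi (0 : ℝ), ‖y * Real.log y * Real.exp (-(b * y))‖ ≤
      b ^ (-(3 / 2) : ℝ) * (2 * Real.Gamma (3 / 2) + Real.Gamma 3) := by
  have hb0 : 0 < b := by linarith
  refine (MeasureTheory.setIntegral_mono_on (integrableOn_mul_log_mul_exp hb0).norm
    (integrableOn_logBound hb0) measurableSet_Ioi
    fun y hy => norm_mul_log_mul_exp_le b hy).trans ?_
  rw [MeasureTheory.integral_add
    ((integrableOn_rpow_mul_exp_neg_mul (p := 3 / 2) (by norm_num) hb0).const_mul 2)
    (integrableOn_rpow_mul_exp_neg_mul (p := 3) (by norm_num) hb0),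
    MeasureTheory.integral_const_mul, Real.integral_rpow_mul_exp_neg_mul_Ioi (by norm_num) hb0,
    Real.integral_rpow_mul_exp_neg_mul_Ioi (by norm_num) hb0, Real.rpow_neg hb0.le,
    ← Real.inv_rpow hb0.le, one_div]
  have h : b⁻¹ ^ (3 : ℝ) ≤ b⁻¹ ^ (3 / 2 : ℝ) :=
    Real.rpow_le_rpow_of_exponent_ge (inv_pos.2 hb0) (inv_le_one_of_one_le₀ hb) (by norm_num)
  have hG : 0 < Real.Gamma 3 := Real.Gamma_pos_of_pos (by norm_num)
  nlinarith

theorem hasSum_exp_neg_freq_mul {y : ℝ} (hy : 0 < y) :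
    HasSum (fun k => Real.exp (-(freq k * y))) (1 / (Real.exp (2 * π * y) - 1)) := by
  have hx : 0 < 2 * π * y := by positivity
  have h1 := one_sub_exp_neg_pos hx
  have h := (hasSum_geometric_of_lt_one (Real.exp_pos (-(2 * π * y))).le (by linarith)).mul_left
    (Real.exp (-(2 * π * y)))
  have e : 1 / (Real.exp (2 * π * y) - 1) =
      Real.exp (-(2 * π * y)) * (1 - Real.exp (-(2 * π * y)))⁻¹ := by
    have h2 : Real.exp (2 * π * y) - 1 ≠ 0 := by
      have := Real.one_lt_exp_iff.2 hx
      linarith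
    rw [Real.exp_neg] at h1 ⊢
    have := Real.exp_pos (2 * π * y)
    field_simp
  rw [e]
  refine h.congr_fun fun k => ?_
  rw [← Real.exp_nat_mul, ← Real.exp_add, freq]
  congr 1
  ring

theorem hasSum_cConst :
    HasSum (fun k => ∫ y in Set.Ioi (0 : ℝ), y * Real.log y * Real.exp (-(freq k * y)))
      cConst := by
  have h := MeasureTheory.hasSum_integral_of_summable_integral_norm
    (μ := MeasureTheory.volume.restrict (Set.Ioi 0))
    (F := fun k (y : ℝ) => y * Real.log y * Real.exp (-(freq k * y)))
    (fun k => integrableOn_mul_log_mul_exp (by linarith [one_le_freq k])) ?_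
  · have e : cConst =
        ∫ y in Set.Ioi (0 : ℝ), ∑' k, y * Real.log y * Real.exp (-(freq k * y)) := by
      refine MeasureTheory.setIntegral_congr_fun measurableSet_Ioi fun y hy => ?_
      rw [((hasSum_exp_neg_freq_mul hy).mul_left (y * Real.log y)).tsum_eq, mul_one_div]
    rw [e]
    exact h
  · exact Summable.of_nonneg_of_le
      (fun k => MeasureTheory.integral_nonneg fun x => norm_nonneg _)
      (fun k => integral_norm_mul_log_mul_exp_le (one_le_freq k))
      (summable_freq_rpow.mul_right _)

/-- A primitive of `a ^ 2 * poleTerm a x - x * log (x / a) * exp (-x)`. -/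
noncomputable def polePrimitive (a x : ℝ) : ℝ :=
  (Real.exp (-x) - 1) * Real.log x + Real.log (a ^ 2 + x ^ 2) / 2 - a ^ 2 / (a ^ 2 + x ^ 2) +
    x * Real.log x * Real.exp (-x) + Real.exp (-x) - Real.log a * ((x + 1) * Real.exp (-x))

theorem polePrimitive_zero {a : ℝ} (ha : 0 < a) : polePrimitive a 0 = 0 := by
  rw [polePrimitive]
  simp [ha.ne']

theorem hasDerivAt_polePrimitive {a x : ℝ} (ha : 0 < a) (hx : 0 < x) :
    HasDerivAt (polePrimitive a)
      (a ^ 2 * poleTerm a x - (x * Real.log x - Real.log a * x) * Real.exp (-x)) x := by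
  have hE : HasDerivAt (fun x => Real.exp (-x)) (-Real.exp (-x)) x := by
    simpa using (hasDerivAt_neg x).exp
  have hL := Real.hasDerivAt_log hx.ne'
  have hQ : HasDerivAt (fun x => a ^ 2 + x ^ 2) (2 * x) x := by
    simpa using (hasDerivAt_pow 2 x).const_add (a ^ 2)
  have hQ0 : a ^ 2 + x ^ 2 ≠ 0 := by positivity
  have hid := hasDerivAt_id x
  have h := ((((((hE.sub_const 1).mul hL).add ((hQ.log hQ0).div_const 2)).sub
    ((hasDerivAt_const x (a ^ 2)).div hQ hQ0)).add ((hid.mul hL).mul hE)).add hE).sub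
    (((hid.add_const 1).mul hE).const_mul (Real.log a))
  refine (h.congr_deriv ?_).congr_of_eventuallyEq (Eventually.of_forall fun y => rfl)
  rw [poleTerm, add_comm (x ^ 2)]
  simp only [id, Pi.mul_apply]
  field_simp
  ring

theorem continuousWithinAt_polePrimitive {a : ℝ} (ha : 0 < a) :
    ContinuousWithinAt (polePrimitive a) (Set.Ici 0) 0 := by
  have h1 : ContinuousWithinAt (fun x : ℝ => (Real.exp (-x) - 1) * Real.log x)
      (Set.Ici 0) 0 := by
    have hc : Tendsto (fun x => |x * Real.log x|) (nhdsWithin 0 (Set.Ici 0)) (nhds 0) :=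
      (Real.continuous_mul_log.abs.tendsto' 0 0 (by simp)).mono_left nhdsWithin_le_nhds
    rw [ContinuousWithinAt, Real.log_zero, mul_zero]
    refine squeeze_zero_norm' ?_ hc
    filter_upwards [self_mem_nhdsWithin] with x hx
    have hx : 0 ≤ x := hx
    rw [Real.norm_eq_abs, abs_mul, abs_mul, abs_of_nonneg hx]
    refine mul_le_mul_of_nonneg_right ?_ (abs_nonneg _)
    have := Real.add_one_le_exp (-x)
    have := Real.exp_le_one_iff.2 (neg_nonpos.2 hx)
    rw [abs_le]
    constructor <;> linarith
  have hQ : ∀ x : ℝ, a ^ 2 + x ^ 2 ≠ 0 := fun x => by positivity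
  have h2 : Continuous fun x : ℝ => Real.log (a ^ 2 + x ^ 2) / 2 :=
    (Continuous.log (by fun_prop) hQ).div_const 2
  have h3 : Continuous fun x : ℝ => a ^ 2 / (a ^ 2 + x ^ 2) := by fun_prop (disch := exact hQ)
  have h4 : Continuous fun x : ℝ => x * Real.log x * Real.exp (-x) :=
    Real.continuous_mul_log.mul (by fun_prop)
  have h5 : Continuous fun x : ℝ => Real.exp (-x) := by fun_prop
  have h6 : Continuous fun x : ℝ => Real.log a * ((x + 1) * Real.exp (-x)) := by fun_prop
  exact ((((h1.add h2.continuousWithinAt).sub h3.continuousWithinAt).add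
    h4.continuousWithinAt).add h5.continuousWithinAt).sub h6.continuousWithinAt

theorem tendsto_polePrimitive_atTop {a : ℝ} (ha : 0 < a) :
    Tendsto (polePrimitive a) atTop (nhds 0) := by
  have e0 : Tendsto (fun x => Real.exp (-x)) atTop (nhds 0) :=
    Real.tendsto_exp_neg_atTop_nhds_zero
  have e1 : Tendsto (fun x => x * Real.exp (-x)) atTop (nhds 0) := by
    simpa using Real.tendsto_pow_mul_exp_neg_atTop_nhds_zero 1
  have e2 := Real.tendsto_pow_mul_exp_neg_atTop_nhds_zero 2
  have l1 : Tendsto (fun x => Real.exp (-x) * Real.log x) atTop (nhds 0) := by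
    refine squeeze_zero' ?_ ?_ e1
    · filter_upwards [eventually_ge_atTop 1] with x hx
      exact mul_nonneg (Real.exp_pos _).le (Real.log_nonneg hx)
    · filter_upwards [eventually_ge_atTop 1] with x hx
      rw [mul_comm]
      exact mul_le_mul_of_nonneg_right (Real.log_le_self (by linarith)) (Real.exp_pos _).le
  have l2 : Tendsto (fun x => x * Real.log x * Real.exp (-x)) atTop (nhds 0) := by
    refine squeeze_zero' ?_ ?_ e2
    · filter_upwards [eventually_ge_atTop 1] with x hx
      have := Real.log_nonneg hx
      positivity
    · filter_upwards [eventually_ge_atTop 1] with x hx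
      have := Real.log_le_self (by linarith : (0 : ℝ) ≤ x)
      refine mul_le_mul_of_nonneg_right ?_ (Real.exp_pos _).le
      nlinarith
  have hi : Tendsto (fun x : ℝ => a ^ 2 / x ^ 2) atTop (nhds 0) :=
    (tendsto_pow_atTop two_ne_zero).const_div_atTop _
  have q1 : Tendsto (fun x : ℝ => Real.log (1 + a ^ 2 / x ^ 2) / 2) atTop (nhds 0) := by
    have h1 : Tendsto (fun x : ℝ => 1 + a ^ 2 / x ^ 2) atTop (nhds 1) := by
      simpa using hi.const_add 1
    have := ((Real.continuousAt_log one_ne_zero).tendsto.comp h1).div_const 2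
    rw [Real.log_one, zero_div] at this
    exact this
  have q2 : Tendsto (fun x : ℝ => a ^ 2 / (a ^ 2 + x ^ 2)) atTop (nhds 0) :=
    (tendsto_atTop_add_const_left _ _ (tendsto_pow_atTop two_ne_zero)).const_div_atTop _
  have h := ((((l1.add q1).sub q2).add l2).add e0).sub ((e1.add e0).const_mul (Real.log a))
  norm_num at h
  refine h.congr' ?_
  filter_upwards [eventually_gt_atTop 0] with x hx
  have hlog : Real.log (1 + a ^ 2 / x ^ 2) = Real.log (a ^ 2 + x ^ 2) - 2 * Real.log x := by
    rw [show 1 + a ^ 2 / x ^ 2 = (a ^ 2 + x ^ 2) / x ^ 2 by field_simp; ring,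
      Real.log_div (by positivity) (by positivity), Real.log_pow]
    norm_num
  rw [polePrimitive, hlog]
  ring

theorem integral_poleTerm {a : ℝ} (ha : 1 ≤ a) :
    ∫ x in Set.Ioi (0 : ℝ), poleTerm a x =
      ∫ y in Set.Ioi (0 : ℝ), y * Real.log y * Real.exp (-(a * y)) := by
  have ha0 : 0 < a := by linarith
  have i1 : MeasureTheory.IntegrableOn (fun x : ℝ => x * Real.log x * Real.exp (-x))
      (Set.Ioi 0) := by
    simpa using integrableOn_mul_log_mul_exp one_pos
  have i2 : MeasureTheory.IntegrableOn (fun x : ℝ => x * Real.exp (-x)) (Set.Ioi 0) := by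
    have := integrableOn_rpow_mul_exp_neg_mul two_pos one_pos
    norm_num at this
    exact this
  have i3 : MeasureTheory.IntegrableOn
      (fun x : ℝ => (x * Real.log x - Real.log a * x) * Real.exp (-x)) (Set.Ioi 0) := by
    refine (i1.sub (i2.const_mul (Real.log a))).congr_fun (fun x _ => ?_) measurableSet_Ioi
    simp only [Pi.sub_apply]
    ring
  have i4 := (integrableOn_poleTerm ha).const_mul (a ^ 2)
  have h := MeasureTheory.integral_Ioi_of_hasDerivAt_of_tendsto
    (continuousWithinAt_polePrimitive ha0)
    (fun x hx => hasDerivAt_polePrimitive ha0 hx) (i4.sub i3) (tendsto_polePrimitive_atTop ha0)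
  rw [polePrimitive_zero ha0, MeasureTheory.integral_sub i4 i3,
    MeasureTheory.integral_const_mul, sub_zero, sub_eq_zero] at h
  have hs := MeasureTheory.integral_comp_mul_left_Ioi
    (fun x => (x * Real.log x - Real.log a * x) * Real.exp (-x)) 0 ha0
  rw [mul_zero, smul_eq_mul, ← h] at hs
  have e : ∫ y in Set.Ioi (0 : ℝ), (a * y * Real.log (a * y) - Real.log a * (a * y)) *
      Real.exp (-(a * y)) = a * ∫ y in Set.Ioi (0 : ℝ), y * Real.log y * Real.exp (-(a * y)) := by
    rw [← MeasureTheory.integral_const_mul]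
    refine MeasureTheory.setIntegral_congr_fun measurableSet_Ioi fun y hy => ?_
    have hy : 0 < y := hy
    rw [Real.log_mul ha0.ne' hy.ne']
    ring
  rw [e] at hs
  field_simp at hs
  exact hs.symm

theorem integral_zetaRemainder : ∫ x in Set.Ioi (0 : ℝ), zetaRemainder x = 2 * cConst := by
  refine hasSum_integral_poleTerm.unique ((hasSum_cConst.mul_left 2).congr_fun fun k => ?_)
  rw [integral_poleTerm (one_le_freq k)]

theorem tendsto_logMoment_zero :
    Tendsto (fun s => logMoment 0 s - zeta3 / s ^ 2 - Real.log s / 12)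
      (nhdsWithin 0 (Set.Ioi 0)) (nhds (2 * cConst)) := by
  rw [← integral_zetaRemainder]
  exact tendsto_logMoment_zero_integral

theorem norm_exp_I_mul_sub_taylor_le (y : ℝ) :
    ‖Complex.exp (Complex.I * y) - 1 - Complex.I * y + y ^ 2 / 2‖ ≤ 4 * |y| ^ 3 := by
  rcases le_total |y| 1 with hy | hy
  · have h := Complex.norm_exp_sub_sum_le_norm_mul_exp (Complex.I * y) 3
    simp only [Finset.sum_range_succ, Finset.sum_range_zero, norm_mul, Complex.norm_I, one_mul,
      Complex.norm_real, Real.norm_eq_abs] at h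
    have e : Complex.exp (Complex.I * y) - 1 - Complex.I * y + y ^ 2 / 2 =
        Complex.exp (Complex.I * y) - (0 + (Complex.I * y) ^ 0 / (Nat.factorial 0 : ℕ) +
          (Complex.I * y) ^ 1 / (Nat.factorial 1 : ℕ) +
          (Complex.I * y) ^ 2 / (Nat.factorial 2 : ℕ)) := by
      simp [mul_pow, Nat.factorial]; ring
    rw [e]
    refine h.trans ?_
    have : Real.exp |y| ≤ 4 := (Real.exp_le_exp.2 hy).trans (by
      have := Real.exp_one_lt_d9; linarith)
    rw [mul_comm]
    gcongr
  · have h1 : ‖Complex.exp (Complex.I * y)‖ = 1 := by simp [Complex.norm_exp]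
    have h2 : ‖Complex.I * (y : ℂ)‖ = |y| := by simp
    have h3 : ‖(y : ℂ) ^ 2 / 2‖ = |y| ^ 2 / 2 := by simp
    calc _ ≤ ‖Complex.exp (Complex.I * y)‖ + ‖(1 : ℂ)‖ + ‖Complex.I * (y : ℂ)‖ +
          ‖(y : ℂ) ^ 2 / 2‖ :=
          (norm_add_le _ _).trans (add_le_add_left ((norm_sub_le _ _).trans
            (add_le_add_left (norm_sub_le _ _) _)) _)
      _ = 2 + |y| + |y| ^ 2 / 2 := by rw [h1, h2, h3, norm_one]; ring
      _ ≤ 4 * |y| ^ 3 := by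
        generalize |y| = u at hy
        nlinarith [mul_nonneg (sub_nonneg.2 hy) (sub_nonneg.2 hy), pow_le_pow_left₀ zero_le_one hy 2,
          mul_nonneg (mul_nonneg (zero_le_one.trans hy) (zero_le_one.trans hy)) (sub_nonneg.2 hy)]

theorem norm_circleExponent_sub_le (n : ℕ) {s : ℝ} (hs : 0 < s) (θ : ℝ) :
    ‖circleExponent n s θ - (Complex.I * (θ * (logMoment 1 s - n) : ℝ) -
      (θ ^ 2 * logMoment 2 s / 2 : ℝ))‖ ≤ 4 * |θ| ^ 3 * logMoment 3 s := by
  let c : ℕ × ℕ → ℝ := fun q => pairWeight q * Real.exp (-s) ^ pairDegree q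
  have hc : ∀ q, 0 ≤ c q := fun q => by have := pairWeight_pos q; positivity
  have h0 : Summable fun q => (c q : ℂ) := by
    simpa [c] using summable_pairWeight_mul_exp hs 0
  have hM : ∀ p, HasSum (fun q => (c q : ℂ) * (pairDegree q : ℂ) ^ p) (logMoment p s : ℂ) := by
    intro p
    have := (Complex.hasSum_ofReal.2 (summable_logMoment p hs).hasSum)
    refine this.congr_fun ?_
    intro q
    simp only [c]
    push_cast
    ring
  have hE : Summable fun q => (c q : ℂ) * Complex.exp (Complex.I * pairDegree q * θ) :=
    summable_pairWeight_mul_exp hs θ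
  have key : HasSum (fun q => (c q : ℂ) * (Complex.exp (Complex.I * (pairDegree q * θ : ℝ)) - 1 -
      Complex.I * (pairDegree q * θ : ℝ) + (pairDegree q * θ : ℝ) ^ 2 / 2))
      (circleExponent n s θ - (Complex.I * (θ * (logMoment 1 s - n) : ℝ) -
      (θ ^ 2 * logMoment 2 s / 2 : ℝ))) := by
    have := (((hE.sub h0).hasSum.sub ((hM 1).mul_left (Complex.I * θ))).add
      ((hM 2).mul_left ((θ : ℂ) ^ 2 / 2)))
    have e : circleExponent n s θ - (Complex.I * (θ * (logMoment 1 s - n) : ℝ) -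
        (θ ^ 2 * logMoment 2 s / 2 : ℝ)) = ∑' q, ((c q : ℂ) *
          Complex.exp (Complex.I * pairDegree q * θ) - c q) - Complex.I * θ * logMoment 1 s +
          θ ^ 2 / 2 * logMoment 2 s := by
      simp only [circleExponent, mul_sub, mul_one, c]
      push_cast
      ring
    rw [e]
    refine this.congr_fun fun q => ?_
    push_cast
    rw [← mul_assoc Complex.I]
    ring
  have hM3 : HasSum (fun q => 4 * |θ| ^ 3 * (c q * (pairDegree q : ℝ) ^ 3))
      (4 * |θ| ^ 3 * logMoment 3 s) := by
    refine HasSum.mul_left _ ((summable_logMoment 3 hs).hasSum.congr_fun fun q => ?_)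
    simp only [c]
    ring
  rw [← key.tsum_eq]
  refine tsum_of_norm_bounded hM3 fun q => ?_
  rw [norm_mul, Complex.norm_real, Real.norm_of_nonneg (hc q)]
  refine (mul_le_mul_of_nonneg_left (norm_exp_I_mul_sub_taylor_le _) (hc q)).trans (le_of_eq ?_)
  rw [abs_mul, Nat.abs_cast]
  ring

theorem tendsto_circleExponent {s : ℕ → ℝ} (hs : Tendsto s atTop (nhdsWithin 0 (Set.Ioi 0)))
    (hn : ∀ᶠ n : ℕ in atTop, (n : ℝ) = 2 * zeta3 / s n ^ 3) (t : ℝ) :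
    Tendsto (fun n => circleExponent n (s n) (s n ^ 2 * t)) atTop
      (nhds ((-(3 * zeta3) * t ^ 2 : ℝ) : ℂ)) := by
  have h1 : Tendsto (fun n => s n ^ 2 * (logMoment 1 (s n) - 2 * zeta3 / s n ^ 3)) atTop (nhds 0) :=
    tendsto_logMoment_one.comp hs
  have h2 : Tendsto (fun n => s n ^ 4 * logMoment 2 (s n)) atTop (nhds (6 * zeta3)) :=
    tendsto_logMoment_two.comp hs
  have h3 : Tendsto (fun n => s n ^ 6 * logMoment 3 (s n)) atTop (nhds 0) :=
    tendsto_logMoment_three.comp hs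
  have hpos : ∀ᶠ n in atTop, 0 < s n := hs.eventually self_mem_nhdsWithin
  have hmain : Tendsto (fun n : ℕ => Complex.I * ((s n ^ 2 * t) * (logMoment 1 (s n) - n) : ℝ) -
      ((s n ^ 2 * t) ^ 2 * logMoment 2 (s n) / 2 : ℝ)) atTop
      (nhds (Complex.I * ((t * 0 : ℝ) : ℂ) - ((t ^ 2 * (6 * zeta3) / 2 : ℝ) : ℂ))) := by
    refine (((Complex.continuous_ofReal.tendsto _).comp (Tendsto.congr' ?_
      (h1.const_mul t))).const_mul _).sub ((Complex.continuous_ofReal.tendsto _).comp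
      (((h2.const_mul (t ^ 2)).div_const 2).congr fun n => ?_))
    · filter_upwards [hn] with n hn
      simp only [← hn]
      ring
    · ring
  have herr : Tendsto (fun n : ℕ => circleExponent n (s n) (s n ^ 2 * t) -
      (Complex.I * ((s n ^ 2 * t) * (logMoment 1 (s n) - n) : ℝ) -
      ((s n ^ 2 * t) ^ 2 * logMoment 2 (s n) / 2 : ℝ))) atTop (nhds 0) := by
    refine squeeze_zero_norm' ?_ (by simpa using (h3.const_mul (4 * |t| ^ 3)))
    filter_upwards [hpos] with n hn
    refine (norm_circleExponent_sub_le n hn _).trans (le_of_eq ?_)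
    rw [abs_mul, abs_of_nonneg (sq_nonneg (s n))]
    ring
  have := herr.add hmain
  simp only [sub_add_cancel, zero_add] at this
  convert this using 2
  push_cast
  ring

theorem hasSum_succ_mul_pow_succ {z : ℂ} (hz : ‖z‖ < 1) :
    HasSum (fun k : ℕ => ((k + 1 : ℝ) : ℂ) * z ^ (k + 1)) (z / (1 - z) ^ 2) := by
  have := hasSum_coe_mul_geometric_of_norm_lt_one hz
  rw [← hasSum_nat_add_iff' 1] at this
  simpa using this

theorem re_circleExponent_le (n : ℕ) {s : ℝ} (hs : 0 < s) (θ : ℝ) :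
    (circleExponent n s θ).re ≤ Real.exp (-s) / Complex.normSq (1 - Real.exp (-s) *
      Complex.exp (Complex.I * θ)) - Real.exp (-s) / (1 - Real.exp (-s)) ^ 2 := by
  set r := Real.exp (-s) with hr
  have hr0 : 0 < r := Real.exp_pos _
  have hr1 : r < 1 := Real.exp_lt_one_iff.2 (neg_lt_zero.2 hs)
  have h0 : Summable fun q : ℕ × ℕ => ((pairWeight q * r ^ pairDegree q : ℝ) : ℂ) := by
    simpa [hr] using summable_pairWeight_mul_exp hs 0
  have hE : Summable fun q : ℕ × ℕ => ((pairWeight q * r ^ pairDegree q : ℝ) : ℂ) *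
      (Complex.exp (Complex.I * pairDegree q * θ) - 1) := by
    simpa [hr, mul_sub] using (summable_pairWeight_mul_exp hs θ).sub (summable_pairWeight_mul_exp hs 0)
  let g : ℕ × ℕ → ℝ := fun q => pairWeight q * r ^ pairDegree q *
    (1 - Real.cos (pairDegree q * θ))
  have hre : ∀ q : ℕ × ℕ, (((pairWeight q * r ^ pairDegree q : ℝ) : ℂ) *
      (Complex.exp (Complex.I * pairDegree q * θ) - 1)).re = -g q := by
    intro q
    rw [Complex.re_ofReal_mul, Complex.sub_re, Complex.exp_re]
    simp [g]
    ring
  have hg : HasSum g (-(circleExponent n s θ).re) := by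
    have := (Complex.hasSum_re hE.hasSum).neg
    simp only [hre, neg_neg] at this
    have e : (Complex.I * n * θ).re = 0 := by simp
    rwa [circleExponent, Complex.sub_re, e, sub_zero]
  have hg0 : ∀ q, 0 ≤ g q := fun q => by
    have := pairWeight_pos q
    have := Real.cos_le_one (pairDegree q * θ)
    simp only [g]
    have : 0 ≤ 1 - Real.cos (pairDegree q * θ) := by linarith
    positivity
  have hinj : Function.Injective fun k : ℕ => (k, 0) := fun a b h => congrArg Prod.fst h
  have hle := tsum_comp_le_tsum_of_inj hg.summable hg0 hinj
  rw [hg.tsum_eq] at hle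
  set z : ℂ := r * Complex.exp (Complex.I * θ) with hz
  have hzn : ‖z‖ = r := by
    simp [hz, Complex.norm_exp, abs_of_pos hr0]
  have h1 := Complex.hasSum_re (hasSum_succ_mul_pow_succ (z := z) (by rwa [hzn]))
  have h2 := Complex.hasSum_re (hasSum_succ_mul_pow_succ (z := (r : ℂ)) (by
    rwa [Complex.norm_real, Real.norm_of_nonneg hr0.le]))
  have h3 : HasSum (fun k : ℕ => g (k, 0)) ((r / (1 - r) ^ 2) - (z / (1 - z) ^ 2).re) := by
    have := h2.sub h1
    have e : ((r : ℂ) / (1 - r) ^ 2).re = r / (1 - r) ^ 2 := by norm_cast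
    rw [e] at this
    refine this.congr_fun fun k => ?_
    rw [Complex.re_ofReal_mul, Complex.re_ofReal_mul, hz, mul_pow, ← Complex.ofReal_pow,
      Complex.re_ofReal_mul, ← Complex.exp_nat_mul, Complex.exp_re, Complex.ofReal_re]
    simp [g, pairWeight, pairDegree]
    ring
  rw [show (g ∘ fun k : ℕ => (k, 0)) = fun k => g (k, 0) from rfl, h3.tsum_eq] at hle
  have h4 : (z / (1 - z) ^ 2).re ≤ r / Complex.normSq (1 - z) := by
    refine (Complex.re_le_norm _).trans (le_of_eq ?_)
    rw [norm_div, norm_pow, hzn, Complex.normSq_eq_norm_sq]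
  linarith

theorem normSq_one_sub_mul_exp (r θ : ℝ) :
    Complex.normSq (1 - r * Complex.exp (Complex.I * θ)) =
      (1 - r) ^ 2 + 2 * r * (1 - Real.cos θ) := by
  rw [mul_comm Complex.I, Complex.exp_mul_I, ← Complex.ofReal_cos, ← Complex.ofReal_sin,
    Complex.normSq_apply]
  simp only [Complex.sub_re, Complex.sub_im, Complex.one_re, Complex.one_im, Complex.re_ofReal_mul,
    Complex.im_ofReal_mul, Complex.add_re, Complex.add_im, Complex.ofReal_re, Complex.ofReal_im,
    Complex.mul_I_re, Complex.mul_I_im]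
  linear_combination r ^ 2 * Real.sin_sq_add_cos_sq θ

theorem re_circleExponent_le_linear (n : ℕ) {s : ℝ} (hs : 0 < s) (hs1 : s ≤ 1) {t : ℝ}
    (ht : |s ^ 2 * t| ≤ π) : (circleExponent n s (s ^ 2 * t)).re ≤ (2 - |t|) / 12 := by
  refine (re_circleExponent_le n hs _).trans ?_
  rw [normSq_one_sub_mul_exp]
  have hcos := Real.cos_le_one_sub_mul_cos_sq ht
  set r := Real.exp (-s) with hr
  have hr1 : r < 1 := Real.exp_lt_one_iff.2 (neg_lt_zero.2 hs)
  have hr3 : 1 / 3 ≤ r := by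
    have h1 : Real.exp (-1) ≤ r := Real.exp_le_exp.2 (by linarith)
    have h2 := Real.exp_neg_one_gt_d9
    linarith
  have hrs : 1 - r ≤ s := by have := Real.one_sub_le_exp_neg s; linarith
  have hπ : π ^ 2 ≤ 10 := by nlinarith [Real.pi_lt_d2, Real.pi_pos]
  set X := 2 * r * (1 - Real.cos (s ^ 2 * t)) with hX
  have hXY : 2 / 15 * (s ^ 4 * t ^ 2) ≤ X := by
    have : 1 / 5 * (s ^ 2 * t) ^ 2 ≤ 1 - Real.cos (s ^ 2 * t) := by
      have : 1 / 5 ≤ 2 / π ^ 2 := by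
        rw [div_le_div_iff₀ (by norm_num) (by positivity)]; linarith
      have := mul_le_mul_of_nonneg_right this (sq_nonneg (s ^ 2 * t))
      linarith
    have h := mul_le_mul (mul_le_mul_of_nonneg_left hr3 (zero_le_two)) this (by positivity)
      (by linarith)
    rw [hX]
    refine le_trans (le_of_eq ?_) h
    ring
  have hX0 : 0 ≤ X := le_trans (by positivity) hXY
  have hD : 0 < (1 - r) ^ 2 := by have : 0 < 1 - r := by linarith
                                  positivity
  have hDs : (1 - r) ^ 2 ≤ s ^ 2 := pow_le_pow_left₀ (by linarith) hrs 2
  have hst : s ^ 2 * |t| ≤ 4 := by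
    rw [abs_mul, abs_of_nonneg (sq_nonneg s)] at ht
    linarith [Real.pi_le_four]
  have key : 1 / 3 * (t ^ 2 / (15 / 2 + 4 * |t|)) ≤ r * (X / ((1 - r) ^ 2 * ((1 - r) ^ 2 + X))) := by
    refine mul_le_mul hr3 ?_ (by positivity) (by linarith)
    calc t ^ 2 / (15 / 2 + 4 * |t|) ≤ (2 / 15 * (s ^ 4 * t ^ 2)) /
          (s ^ 2 * (s ^ 2 + 2 / 15 * (s ^ 4 * t ^ 2))) := by
          rw [div_le_div_iff₀ (by positivity) (by positivity)]
          have : s ^ 2 * t ^ 2 ≤ 4 * |t| := by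
            rw [← sq_abs t]; nlinarith [abs_nonneg t]
          have h4 : 0 ≤ s ^ 4 * t ^ 2 := by positivity
          nlinarith
      _ ≤ X / (s ^ 2 * (s ^ 2 + X)) := by
          rw [div_le_div_iff₀ (by positivity) (by positivity)]
          have h4 : 0 ≤ s ^ 4 := by positivity
          nlinarith
      _ ≤ _ := by gcongr
  have e : r / ((1 - r) ^ 2 + X) - r / (1 - r) ^ 2 =
      -(r * (X / ((1 - r) ^ 2 * ((1 - r) ^ 2 + X)))) := by
    have h1 : (1 - r) ^ 2 + X ≠ 0 := by positivity
    have h2 : (1 - r) ^ 2 ≠ 0 := hD.ne'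
    generalize (1 - r) ^ 2 = d at h1 h2
    field_simp
    ring
  rw [e]
  have : (|t| - 2) / 12 ≤ 1 / 3 * (t ^ 2 / (15 / 2 + 4 * |t|)) := by
    rw [← mul_div_assoc, div_le_div_iff₀ (by norm_num) (by positivity), ← sq_abs t]
    nlinarith [abs_nonneg t]
  linarith

theorem continuous_circleExponent (n : ℕ) {s : ℝ} (hs : 0 < s) :
    Continuous (circleExponent n s) := by
  refine Continuous.sub (continuous_tsum (u := fun q => 2 * (pairWeight q * (pairDegree q : ℝ) ^ 0 *
    Real.exp (-s) ^ pairDegree q)) (fun q => by fun_prop) ((summable_logMoment 0 hs).mul_left 2)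
    fun q θ => ?_) (by fun_prop)
  have := pairWeight_pos q
  rw [norm_mul, Complex.norm_real, Real.norm_of_nonneg (by positivity), pow_zero, mul_one, mul_comm]
  refine mul_le_mul_of_nonneg_right ((norm_sub_le _ _).trans (le_of_eq ?_)) (by positivity)
  rw [Complex.norm_exp]
  norm_num

theorem tendsto_integral_exp_circleExponent {s : ℕ → ℝ}
    (hs : Tendsto s atTop (nhdsWithin 0 (Set.Ioi 0)))
    (hn : ∀ᶠ n : ℕ in atTop, (n : ℝ) = 2 * zeta3 / s n ^ 3) :
    Tendsto (fun n => ((s n ^ 2 : ℝ) : ℂ)⁻¹ * ∫ θ in (-π)..π, Complex.exp (circleExponent n (s n) θ))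
      atTop (nhds ((√(π / (3 * zeta3)) : ℝ) : ℂ)) := by
  have hpos : ∀ᶠ n in atTop, 0 < s n := hs.eventually self_mem_nhdsWithin
  have hs0 : Tendsto s atTop (nhds 0) := hs.mono_right nhdsWithin_le_nhds
  have hone : ∀ᶠ n in atTop, s n ≤ 1 := (hs0.eventually (gt_mem_nhds one_pos)).mono fun _ h => h.le
  rw [← integral_gaussian, ← integral_complex_ofReal]
  have hlim : Tendsto (fun n => ∫ t : ℝ, (Set.Ioc (-π / s n ^ 2) (π / s n ^ 2)).indicator
      (fun t => Complex.exp (circleExponent n (s n) (s n ^ 2 * t))) t) atTop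
      (nhds (∫ t : ℝ, ((Real.exp (-(3 * zeta3) * t ^ 2) : ℝ) : ℂ))) := by
    refine MeasureTheory.tendsto_integral_filter_of_dominated_convergence
      (fun t => Real.exp (1 / 6) * Real.exp (-(1 / 12) * |t|)) ?_ ?_ ?_ ?_
    · filter_upwards [hpos] with n hn
      have := (continuous_circleExponent n hn)
      refine Continuous.aestronglyMeasurable (by fun_prop) |>.indicator measurableSet_Ioc
    · filter_upwards [hpos, hone] with n hn h1
      refine Eventually.of_forall fun t => ?_
      rw [Set.indicator_apply]
      split_ifs with ht
      · rw [Complex.norm_exp, ← Real.exp_add, Real.exp_le_exp]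
        have : |s n ^ 2 * t| ≤ π := by
          rw [Set.mem_Ioc, div_lt_iff₀ (by positivity), le_div_iff₀ (by positivity)] at ht
          rw [abs_le]
          constructor <;> nlinarith [ht.1, ht.2]
        have := re_circleExponent_le_linear n hn h1 this
        linarith
      · simp; positivity
    · refine MeasureTheory.Integrable.const_mul (not_imp_comm.1 MeasureTheory.integral_undef ?_) _
      rw [integral_comp_abs (f := fun t => Real.exp (-(1 / 12) * t)),
        integral_exp_mul_Ioi (by norm_num)]
      norm_num
    · refine Eventually.of_forall fun t => ?_
      have h := (tendsto_circleExponent hs hn t).cexp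
      rw [← Complex.ofReal_exp] at h
      refine h.congr' ?_
      have hs2 : Tendsto (fun n => s n ^ 2 * |t|) atTop (nhds 0) := by
        simpa using (hs0.pow 2).mul_const |t|
      filter_upwards [hpos, hs2.eventually (gt_mem_nhds Real.pi_pos)] with n hn h2
      rw [Set.indicator_of_mem]
      rw [Set.mem_Ioc, div_lt_iff₀ (by positivity), le_div_iff₀ (by positivity)]
      constructor <;> nlinarith [neg_abs_le t, le_abs_self t, sq_nonneg (s n), pow_pos hn 2]
  refine hlim.congr' ?_
  filter_upwards [hpos] with n hn
  have hsq : s n ^ 2 ≠ 0 := by positivity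
  rw [MeasureTheory.integral_indicator measurableSet_Ioc, ← intervalIntegral.integral_of_le]
  · have := intervalIntegral.integral_comp_mul_left (a := -π / s n ^ 2) (b := π / s n ^ 2)
      (fun θ => Complex.exp (circleExponent n (s n) θ)) hsq
    rw [this, mul_div_cancel₀ _ hsq, mul_div_cancel₀ _ hsq, Complex.real_smul, Complex.ofReal_inv]
  · gcongr
    linarith [Real.pi_pos]

theorem zeta3_pos : 0 < zeta3 :=
  (summable_one_div_succ_pow (by norm_num)).tsum_pos (fun _ => by positivity) 0 (by norm_num)

/-- The saddle point for the number of plane partitions of `n`. -/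
noncomputable def saddlePoint (n : ℕ) : ℝ := (2 * zeta3 / n) ^ ((1 : ℝ) / 3)

theorem saddlePoint_pos {n : ℕ} (hn : n ≠ 0) : 0 < saddlePoint n := by
  have := zeta3_pos
  unfold saddlePoint
  positivity

theorem natCast_eq_div_saddlePoint_pow {n : ℕ} (hn : n ≠ 0) :
    (n : ℝ) = 2 * zeta3 / saddlePoint n ^ 3 := by
  have := zeta3_pos
  rw [saddlePoint, ← Real.rpow_natCast, ← Real.rpow_mul (by positivity)]
  norm_num
  field_simp

theorem tendsto_saddlePoint : Tendsto saddlePoint atTop (nhdsWithin 0 (Set.Ioi 0)) := by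
  refine tendsto_nhdsWithin_iff.2 ⟨?_, (eventually_ne_atTop 0).mono fun n hn => saddlePoint_pos hn⟩
  have := (tendsto_const_div_atTop_nhds_zero_nat (2 * zeta3)).rpow_const
    (p := (1 : ℝ) / 3) (Or.inr (by norm_num))
  rw [Real.zero_rpow (by norm_num)] at this
  exact this

theorem wright_main_term {n : ℕ} (hn : n ≠ 0) :
    zeta3 ^ ((7 : ℝ) / 36) / (2 ^ ((11 : ℝ) / 36) * 3 ^ ((1 : ℝ) / 2) * π ^ ((1 : ℝ) / 2)) *
      (n : ℝ) ^ (-(25 : ℝ) / 36) *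
      Real.exp (3 * zeta3 ^ ((1 : ℝ) / 3) * ((n : ℝ) / 2) ^ ((2 : ℝ) / 3) + 2 * cConst) =
    saddlePoint n ^ 2 / (2 * π) * √(π / (3 * zeta3)) * Real.exp (n * saddlePoint n +
      zeta3 / saddlePoint n ^ 2 + Real.log (saddlePoint n) / 12 + 2 * cConst) := by
  have hz := zeta3_pos
  have hs := saddlePoint_pos hn
  have hns := natCast_eq_div_saddlePoint_pow hn
  set s := saddlePoint n
  have hexp : 3 * zeta3 ^ ((1 : ℝ) / 3) * ((n : ℝ) / 2) ^ ((2 : ℝ) / 3) =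
      n * s + zeta3 / s ^ 2 := by
    have e1 : (n : ℝ) / 2 = zeta3 / s ^ (3 : ℝ) := by
      rw [hns]; norm_cast; field_simp
    have e2 : (s ^ (3 : ℝ)) ^ ((2 : ℝ) / 3) = s ^ 2 := by
      rw [← Real.rpow_mul hs.le, ← Real.rpow_natCast]; norm_num
    rw [e1, Real.div_rpow hz.le (by positivity), e2, mul_div_assoc', mul_assoc,
      ← Real.rpow_add hz, hns]
    norm_num
    field_simp
    ring
  have hlog : Real.log n = Real.log 2 + Real.log zeta3 - 3 * Real.log s := by
    rw [hns, Real.log_div (by positivity) (by positivity), Real.log_mul (by norm_num) hz.ne',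
      Real.log_pow]
    norm_num
  have hpre : zeta3 ^ ((7 : ℝ) / 36) / (2 ^ ((11 : ℝ) / 36) * 3 ^ ((1 : ℝ) / 2) *
      π ^ ((1 : ℝ) / 2)) * (n : ℝ) ^ (-(25 : ℝ) / 36) =
      s ^ 2 / (2 * π) * √(π / (3 * zeta3)) * Real.exp (Real.log s / 12) := by
    have hn0 : (0 : ℝ) < n := by positivity
    have hπ := Real.pi_pos
    apply Real.log_injOn_pos (Set.mem_Ioi.2 (by positivity)) (Set.mem_Ioi.2 (by positivity))
    rw [Real.log_mul (by positivity) (by positivity), Real.log_div (by positivity) (by positivity),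
      Real.log_mul (by positivity) (by positivity), Real.log_mul (by positivity) (by positivity),
      Real.log_mul (by positivity) (by positivity), Real.log_mul (by positivity) (by positivity),
      Real.log_div (by positivity) (by positivity), Real.log_mul (by positivity) (by positivity),
      Real.log_sqrt (by positivity), Real.log_div (by positivity) (by positivity),
      Real.log_mul (by positivity) (by positivity), Real.log_exp, Real.log_rpow hz,
      Real.log_rpow (by norm_num), Real.log_rpow (by norm_num), Real.log_rpow hπ,
      Real.log_rpow hn0, Real.log_pow, hlog]
    push_cast
    ring
  rw [hexp, hpre, Real.exp_add, Real.exp_add (_ + _) (2 * cConst), Real.exp_add (_ + _) (_ / 12)]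
  ring

theorem ppCount_asymptotics :
    Tendsto (fun n : ℕ =>
        (ppCount n : ℝ) /
          (zeta3 ^ ((7 : ℝ) / 36) / (2 ^ ((11 : ℝ) / 36) * 3 ^ ((1 : ℝ) / 2) * π ^ ((1 : ℝ) / 2)) *
            (n : ℝ) ^ (-(25 : ℝ) / 36) *
            Real.exp (3 * zeta3 ^ ((1 : ℝ) / 3) * ((n : ℝ) / 2) ^ ((2 : ℝ) / 3) + 2 * cConst)))
      atTop (nhds 1) := by
  have hz := zeta3_pos
  have hs := tendsto_saddlePoint
  have hc0 : 0 < √(π / (3 * zeta3)) := by have := Real.pi_pos; positivity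
  have h1 := (Complex.continuous_re.tendsto _).comp (tendsto_integral_exp_circleExponent hs
    ((eventually_ne_atTop 0).mono fun n hn => natCast_eq_div_saddlePoint_pow hn))
  have h2 := (Real.continuous_exp.tendsto _).comp
    ((tendsto_logMoment_zero.comp hs).sub_const (2 * cConst))
  have h3 := (h1.div_const (√(π / (3 * zeta3)))).mul h2
  rw [Complex.ofReal_re, div_self hc0.ne', sub_self, Real.exp_zero, mul_one] at h3
  refine h3.congr' ?_
  filter_upwards [eventually_ne_atTop 0] with n hn
  have hsn := saddlePoint_pos hn
  simp only [Function.comp_apply]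
  rw [wright_main_term hn, integral_exp_circleExponent n hsn, ← Complex.ofReal_inv,
    ← Complex.ofReal_mul, Complex.ofReal_re, eq_div_iff (by have := Real.pi_pos; positivity)]
  have e : ∀ a b c d A : ℝ, Real.exp (-a) * Real.exp (-A) * Real.exp (A - b - c - d) *
      Real.exp (a + b + c + d) = 1 := fun a b c d A => by
    rw [← Real.exp_add, ← Real.exp_add, ← Real.exp_add]
    ring_nf
    exact Real.exp_zero
  have e' := e (n * saddlePoint n) (zeta3 / saddlePoint n ^ 2) (Real.log (saddlePoint n) / 12)
    (2 * cConst) (logMoment 0 (saddlePoint n))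
  have hπ := Real.pi_pos.ne'
  calc _ = (ppCount n : ℝ) * (Real.exp (-(n * saddlePoint n)) *
      Real.exp (-logMoment 0 (saddlePoint n)) * Real.exp (logMoment 0 (saddlePoint n) -
      zeta3 / saddlePoint n ^ 2 - Real.log (saddlePoint n) / 12 - 2 * cConst) *
      Real.exp (n * saddlePoint n + zeta3 / saddlePoint n ^ 2 + Real.log (saddlePoint n) / 12 +
        2 * cConst)) := by
        field_simp
    _ = ppCount n := by rw [e', mul_one]

theorem plane_partition_asymptotics :
    Tendsto (fun n : ℕ =>
        (planePartitionCount n : ℝ) /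
          (zeta3 ^ ((7 : ℝ) / 36) / (2 ^ ((11 : ℝ) / 36) * 3 ^ ((1 : ℝ) / 2) * π ^ ((1 : ℝ) / 2)) *
            (n : ℝ) ^ (-(25 : ℝ) / 36) *
            Real.exp (3 * zeta3 ^ ((1 : ℝ) / 3) * ((n : ℝ) / 2) ^ ((2 : ℝ) / 3) + 2 * cConst)))
      atTop (nhds 1) := by
  refine ppCount_asymptotics.congr' ?_
  filter_upwards [eventually_ne_atTop 0] with n hn
  rw [planePartitionCount_eq hn]
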